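/- arXiv:1912.08461 — 6 statements merged into one kernel-verified Lean document; each statement's English description precedes it below -/
import Mathlib

section
/- Let e≥2, l≥1 and s=(s_1,…,s_l)∈ℤ^l. If an l-partition 𝛌 is a reduced (e,s)-core, then s∈𝒜̄^l_e, i.e. 0≤s_j−s_i≤e for all 1≤i<j≤l. -/
noncomputable section

/-- A partition: a nonincreasing sequence of nonnegative integers with finitely many
nonzero terms. `parts j` is the `(j+1)`-st part `λ_{j+1}` (0-indexed). -/
structure Ptn where
  parts : ℕ → ℕ
  antitone' : ∀ ⦃i j : ℕ⦄, i ≤ j → parts j ≤ parts i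
  eventually_zero : ∃ N, ∀ n, N ≤ n → parts n = 0

/-- The empty partition. -/
def Ptn.empty : Ptn := ⟨fun _ => 0, fun _ _ _ => le_rfl, ⟨0, fun _ _ => rfl⟩⟩

/-- The abacus `L_s(λ) = {λ_j − j + s : j ∈ ℤ_{>0}}` of a partition with charge `s`. -/
def abacus (s : ℤ) (lam : Ptn) : Set ℤ :=
  {x | ∃ j : ℕ, x = (lam.parts j : ℤ) - ((j : ℤ) + 1) + s}

/-- The Young diagram of an `l`-partition, with 0-indexed rows and columns:
`(a, b, c) ∈ diag 𝛌` represents the node in row `a+1`, column `b+1` of component `c`. -/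
def diag {l : ℕ} (lam : Fin l → Ptn) : Set (ℕ × ℕ × Fin l) :=
  {x | x.2.1 < (lam x.2.2).parts x.1}

/-- The rank of an `l`-partition: the number of nodes of its Young diagram. -/
def rank {l : ℕ} (lam : Fin l → Ptn) : ℕ := (diag lam).ncard

/-- The rank of a partition. -/
def rank₁ (lam : Ptn) : ℕ := rank (fun _ : Fin 1 => lam)

/-- The residue of the node `(a,b,c)` (0-indexed), i.e. `(b+1) − (a+1) + s_c mod e`. -/
def res (e : ℕ) {l : ℕ} (s : Fin l → ℤ) (x : ℕ × ℕ × Fin l) : ZMod e :=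
  (((x.2.1 : ℤ) - (x.1 : ℤ) + s x.2.2 : ℤ) : ZMod e)

/-- `c^{e,s}_i(𝛌)`: the number of nodes of `𝛌` of residue `i`. -/
def resCount (e : ℕ) {l : ℕ} (s : Fin l → ℤ) (lam : Fin l → Ptn) (i : ZMod e) : ℕ :=
  {x ∈ diag lam | res e s x = i}.ncard

/-- `c^{e,(t)}_i(λ)` for a single partition with charge `t`. -/
def resCount₁ (e : ℕ) (t : ℤ) (lam : Ptn) (i : ZMod e) : ℕ :=
  resCount e (fun _ : Fin 1 => t) (fun _ => lam) i

/-- A node `γ` of `𝛌` is removable if deleting it yields the Young diagram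
of an `l`-partition. -/
def Removable {l : ℕ} (lam : Fin l → Ptn) (γ : ℕ × ℕ × Fin l) : Prop :=
  γ ∈ diag lam ∧ ∃ mu : Fin l → Ptn, diag mu = diag lam \ {γ}

/-- A node `γ ∉ [𝛌]` is addable for `𝛌` if adding it yields the Young diagram
of an `l`-partition. -/
def Addable {l : ℕ} (lam : Fin l → Ptn) (γ : ℕ × ℕ × Fin l) : Prop :=
  γ ∉ diag lam ∧ ∃ mu : Fin l → Ptn, diag mu = diag lam ∪ {γ}

/-- `M^s_i(𝛌)`: the number of addable nodes of residue `i` minus the number of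
removable nodes of residue `i`. -/
def Mnum (e : ℕ) {l : ℕ} (s : Fin l → ℤ) (lam : Fin l → Ptn) (i : ZMod e) : ℤ :=
  ({γ | Addable lam γ ∧ res e s γ = i}.ncard : ℤ) -
    ({γ | Removable lam γ ∧ res e s γ = i}.ncard : ℤ)

/-- `M^{(t)}_i(λ)` for a single partition with charge `t`. -/
def Mnum₁ (e : ℕ) (t : ℤ) (lam : Ptn) (i : ZMod e) : ℤ :=
  Mnum e (fun _ : Fin 1 => t) (fun _ => lam) i

/-- The block `(e,s)`-weight of Fayers:
`p_{(e,s)}(𝛌) = Σ_{i=1}^{l} c_{s_i}(𝛌) − (1/2) Σ_{i ∈ ℤ/eℤ} (c_i(𝛌) − c_{i−1}(𝛌))²`. -/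
def blockWeight (e : ℕ) {l : ℕ} (s : Fin l → ℤ) (lam : Fin l → Ptn) : ℚ :=
  (∑ i : Fin l, (resCount e s lam ((s i : ZMod e)) : ℚ)) -
    (1 / 2) * ∑ i ∈ Finset.range e,
      ((resCount e s lam ((i : ZMod e)) : ℚ) - (resCount e s lam ((i : ZMod e) - 1) : ℚ)) ^ 2

/-- Block weight of a single partition with charge `t`. -/
def blockWeight₁ (e : ℕ) (t : ℤ) (lam : Ptn) : ℚ :=
  blockWeight e (fun _ : Fin 1 => t) (fun _ => lam)

/-- The `l`-abacus `(L_{s_1}(λ^1),…,L_{s_l}(λ^l))` is `(e,s)`-complete: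
`L_{s_1}(λ^1) ⊆ … ⊆ L_{s_l}(λ^l) ⊆ {x+e : x ∈ L_{s_1}(λ^1)}`. -/
def Complete (e : ℕ) {l : ℕ} (s : Fin l → ℤ) (lam : Fin l → Ptn) : Prop :=
  (∀ i j : Fin l, (j : ℕ) = (i : ℕ) + 1 →
      abacus (s i) (lam i) ⊆ abacus (s j) (lam j)) ∧
  (∀ i j : Fin l, (i : ℕ) = l - 1 → (j : ℕ) = 0 →
      abacus (s i) (lam i) ⊆ {x | x - (e : ℤ) ∈ abacus (s j) (lam j)})

/-- `𝒜̄^l_e = {s ∈ ℤ^l : 0 ≤ s_j − s_i ≤ e for all i < j}`. -/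
def Abar (e : ℕ) {l : ℕ} (s : Fin l → ℤ) : Prop :=
  ∀ i j : Fin l, i < j → 0 ≤ s j - s i ∧ s j - s i ≤ (e : ℤ)

/-- `𝒜^l_e = {s ∈ ℤ^l : 0 ≤ s_j − s_i < e for all i < j}`. -/
def Aset (e : ℕ) {l : ℕ} (s : Fin l → ℤ) : Prop :=
  ∀ i j : Fin l, i < j → 0 ≤ s j - s i ∧ s j - s i < (e : ℤ)

/-- A partition is an `e`-core if its abacus is stable under subtracting `e`
(a condition independent of the charge). -/
def IsECore (e : ℕ) (lam : Ptn) : Prop :=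
  ∀ x ∈ abacus 0 lam, x - (e : ℤ) ∈ abacus 0 lam

/-- The permutation `σ_s`: the unique permutation sorting the residues
`s'_i = s_i mod e ∈ {0,…,e−1}` increasingly and stably. -/
def sigmaPerm (e : ℕ) {l : ℕ} (s : Fin l → ℤ) : Equiv.Perm (Fin l) :=
  Tuple.sort (fun i => s i % (e : ℤ))

/-- `𝛌` is an `(e,s)`-core if `𝛌^{σ_s}` is a reduced `(e, s̃^{σ_s})`-core. -/
def IsCore (e : ℕ) {l : ℕ} (s : Fin l → ℤ) (lam : Fin l → Ptn) : Prop :=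
  Complete e (fun i => s (sigmaPerm e s i) % (e : ℤ)) (fun i => lam (sigmaPerm e s i))

/-- The set `{(l−c)e + q·e·l + r : 1 ≤ c ≤ l, q ∈ ℤ, 0 ≤ r ≤ e−1, qe+r ∈ L_{s_c}(λ^c)}`
(with `c = (c' : Fin l) + 1`). -/
def uglovSet (e : ℕ) {l : ℕ} (s : Fin l → ℤ) (lam : Fin l → Ptn) : Set ℤ :=
  {y | ∃ (c : Fin l) (q : ℤ) (r : ℕ), r < e ∧
      (q * (e : ℤ) + (r : ℤ)) ∈ abacus (s c) (lam c) ∧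
      y = ((l : ℤ) - 1 - ((c : ℕ) : ℤ)) * (e : ℤ) + q * (e : ℤ) * (l : ℤ) + (r : ℤ)}

/-- `μ = τ_{e,s}(𝛌)`: the Uglov map sends `𝛌` to the unique partition `μ` whose abacus
with charge `t = s_1 + … + s_l` is the Uglov set of `(𝛌,s)`. -/
def IsUglov (e : ℕ) {l : ℕ} (s : Fin l → ℤ) (lam : Fin l → Ptn) (mu : Ptn) : Prop :=
  abacus (∑ i, s i) mu = uglovSet e s lam

/-- An elementary operation on a pair (`l`-partition, multicharge), performed on the
associated `l`-abacus. -/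
def ElemOp (e : ℕ) {l : ℕ} (p q : (Fin l → Ptn) × (Fin l → ℤ)) : Prop :=
  (∃ (i j : Fin l) (x : ℤ), (j : ℕ) = (i : ℕ) + 1 ∧
      x ∈ abacus (p.2 i) (p.1 i) ∧ x ∉ abacus (p.2 j) (p.1 j) ∧
      abacus (q.2 i) (q.1 i) = abacus (p.2 i) (p.1 i) \ {x} ∧
      abacus (q.2 j) (q.1 j) = abacus (p.2 j) (p.1 j) ∪ {x} ∧
      q.2 i = p.2 i - 1 ∧ q.2 j = p.2 j + 1 ∧
      (∀ k, k ≠ i → k ≠ j → q.1 k = p.1 k ∧ q.2 k = p.2 k)) ∨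
  (∃ (i j : Fin l) (x : ℤ), (i : ℕ) = l - 1 ∧ (j : ℕ) = 0 ∧
      x ∈ abacus (p.2 i) (p.1 i) ∧ x - (e : ℤ) ∉ abacus (p.2 j) (p.1 j) ∧
      (i = j → abacus (q.2 i) (q.1 i) = (abacus (p.2 i) (p.1 i) \ {x}) ∪ {x - (e : ℤ)} ∧
        q.2 i = p.2 i) ∧
      (i ≠ j → abacus (q.2 i) (q.1 i) = abacus (p.2 i) (p.1 i) \ {x} ∧
        abacus (q.2 j) (q.1 j) = abacus (p.2 j) (p.1 j) ∪ {x - (e : ℤ)} ∧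
        q.2 i = p.2 i - 1 ∧ q.2 j = p.2 j + 1) ∧
      (∀ k, k ≠ i → k ≠ j → q.1 k = p.1 k ∧ q.2 k = p.2 k))

/-- A sequence of `n` elementary operations starting from `p`. -/
def OpSeq (e : ℕ) {l : ℕ} (p : (Fin l → Ptn) × (Fin l → ℤ))
    (f : ℕ → (Fin l → Ptn) × (Fin l → ℤ)) (n : ℕ) : Prop :=
  f 0 = p ∧ ∀ k < n, ElemOp e (f k) (f (k + 1))

/-- A maximal sequence of elementary operations: performed until the resulting
`l`-abacus is complete for the current multicharge. -/
def MaxOpSeq (e : ℕ) {l : ℕ} (p : (Fin l → Ptn) × (Fin l → ℤ))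
    (f : ℕ → (Fin l → Ptn) × (Fin l → ℤ)) (n : ℕ) : Prop :=
  OpSeq e p f n ∧ Complete e (f n).2 (f n).1

/-- `q` is the core of the pair `p`: it is reached from `p` by a maximal sequence
of elementary operations. -/
def IsCorePairOf (e : ℕ) {l : ℕ} (p q : (Fin l → Ptn) × (Fin l → ℤ)) : Prop :=
  ∃ f n, MaxOpSeq e p f n ∧ f n = q

/-- `κ = Core_e(λ)`: on abaci, the abacus of `κ` is obtained from that of `λ` by
repeatedly replacing an element `y` with `y − e ∉ L` by `y − e`, until no such
replacement is possible. -/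
def IsECoreOf (e : ℕ) (kappa lam : Ptn) : Prop :=
  IsECore e kappa ∧ ∃ (f : ℕ → Ptn) (m : ℕ), f 0 = lam ∧ f m = kappa ∧
    ∀ k < m, ∃ y ∈ abacus 0 (f k), y - (e : ℤ) ∉ abacus 0 (f k) ∧
      abacus 0 (f (k + 1)) = (abacus 0 (f k) \ {y}) ∪ {y - (e : ℤ)}

end

theorem charge_le_of_subset (s t : ℤ) (lam mu : Ptn)
    (h : abacus s lam ⊆ abacus t mu) : s ≤ t := by
  obtain ⟨M, hM⟩ := mu.eventually_zero
  choose f hf using fun j : ℕ => h (show (lam.parts j : ℤ) - ((j : ℤ) + 1) + s ∈ abacus s lam from ⟨j, rfl⟩)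
  by_contra hlt
  push Not at hlt
  obtain ⟨d, hd⟩ : ∃ d : ℕ, s = t + d := ⟨(s - t).toNat, by omega⟩
  have hinj : Function.Injective f := by
    intro a b hab
    have h1 := hf a
    have h2 := hf b
    rw [hab] at h1
    rcases lt_trichotomy a b with hl | hl | hl
    · have := lam.antitone' hl.le
      omega
    · exact hl
    · have := lam.antitone' hl.le
      omega
  have hmap : Set.MapsTo f (Finset.range (M + d) : Finset ℕ) (Finset.range M : Finset ℕ) := by
    intro j hj
    simp only [Finset.coe_range, Set.mem_Iio] at hj ⊢
    by_contra hk
    push Not at hk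
    have h1 := hf j
    rw [hM _ hk] at h1
    omega
  have := Finset.card_le_card_of_injOn f hmap hinj.injOn
  simp only [Finset.card_range] at this
  omega

theorem charge_mono {e l : ℕ} {s : Fin l → ℤ} {lam : Fin l → Ptn} (h : Complete e s lam) :
    ∀ (n : ℕ) (i j : Fin l), (j : ℕ) = (i : ℕ) + n → s i ≤ s j := by
  intro n
  induction n with
  | zero =>
    intro i j hij
    have : j = i := Fin.ext (by simpa using hij)
    rw [this]
  | succ n ih =>
    intro i j hij
    have hj := j.isLt
    let k : Fin l := ⟨i + n, by omega⟩
    have h1 := ih i k rfl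
    have h2 := charge_le_of_subset _ _ _ _ (h.1 k j (by simp [k]; omega))
    exact h1.trans h2

theorem abar_of_complete {e l : ℕ} {s : Fin l → ℤ} {lam : Fin l → Ptn}
    (h : Complete e s lam) : Abar e s := by
  intro i j hij
  have hlt : (i : ℕ) < j := hij
  have hj := j.isLt
  let a : Fin l := ⟨0, by omega⟩
  let b : Fin l := ⟨l - 1, by omega⟩
  have h1 := charge_mono h (j - i) i j (by omega)
  have h2 := charge_mono h i a i (by simp [a])
  have h3 := charge_mono h (l - 1 - j) j b (by simp [b]; omega)
  have h4 : s b ≤ s a + e := by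
    apply charge_le_of_subset _ _ (lam b) (lam a)
    intro x hx
    obtain ⟨k, hk⟩ := h.2 b a rfl rfl hx
    exact ⟨k, by omega⟩
  constructor <;> omega

/-- If an `l`-partition `𝛌` is a reduced `(e,s)`-core,
then `s ∈ 𝒜̄^l_e`. -/
theorem stmt0 (e l : ℕ) (he : 2 ≤ e) (hl : 1 ≤ l) (s : Fin l → ℤ)
    (lam : Fin l → Ptn) (h : Complete e s lam) : Abar e s := by
  exact abar_of_complete h
end

section
/- Let e≥2 and s∈𝒜̄^l_e. An l-partition 𝛌 is a reduced (e,s)-core if and only if it is an (e,s)-core. -/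
/-- Order-free form of completeness. -/
def OrdFree (e : ℕ) {l : ℕ} (s : Fin l → ℤ) (lam : Fin l → Ptn) : Prop :=
  ∀ (i j : Fin l) (k : ℤ), s i ≤ s j + k * (e : ℤ) →
    abacus (s i) (lam i) ⊆ abacus (s j + k * (e : ℤ)) (lam j)

theorem mem_abacus_add (s t x : ℤ) (lam : Ptn) :
    x ∈ abacus (s + t) lam ↔ x - t ∈ abacus s lam := by
  constructor
  · rintro ⟨j, hj⟩
    exact ⟨j, by linarith⟩
  · rintro ⟨j, hj⟩
    exact ⟨j, by linarith⟩

theorem abacus_subset_symm (s : ℤ) (lam mu : Ptn) (h : abacus s lam ⊆ abacus s mu) :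
    abacus s mu ⊆ abacus s lam := by
  have h1 : ∀ j : ℕ, ∃ k : ℕ, (lam.parts j : ℤ) - ((j : ℤ) + 1) + s
      = (mu.parts k : ℤ) - ((k : ℤ) + 1) + s := fun j => h ⟨j, rfl⟩
  choose f hf using h1
  have hmono : StrictMono f := by
    intro a b hab
    by_contra hc
    have h2 := mu.antitone' (not_lt.mp hc)
    have h3 := lam.antitone' hab.le
    have ha := hf a
    have hb := hf b
    omega
  obtain ⟨N1, hN1⟩ := lam.eventually_zero
  obtain ⟨N2, hN2⟩ := mu.eventually_zero
  have hfix : ∀ N, N1 ≤ N → N2 ≤ N → f N = N := by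
    intro N h1 h2
    have h3 := hf N
    have h4 := hmono.le_apply (x := N)
    have h5 := hN1 N h1
    have h6 := hN2 (f N) (h2.trans h4)
    omega
  have hall : ∀ j, f j = j := by
    intro j
    have h4 := hmono.le_apply (x := j)
    have h5 : ∀ n, f j + n ≤ f (j + n) := by
      intro n
      induction n with
      | zero => simp
      | succ n ih =>
        have := hmono (show j + n < j + (n + 1) by omega)
        omega
    have h6 := h5 (N1 + N2)
    have h7 := hfix (j + (N1 + N2)) (by omega) (by omega)
    omega
  rintro x ⟨j, hj⟩
  refine ⟨j, ?_⟩
  have := hf j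
  rw [hall j] at this
  rw [hj, this]

theorem complete_iff_ordFree (e l : ℕ) (he : 2 ≤ e) (hl : 1 ≤ l) (s : Fin l → ℤ)
    (hs : Abar e s) (lam : Fin l → Ptn) : Complete e s lam ↔ OrdFree e s lam := by
  constructor
  · rintro ⟨h1, h2⟩
    have chain : ∀ (n : ℕ) (i j : Fin l), (j : ℕ) = (i : ℕ) + n →
        abacus (s i) (lam i) ⊆ abacus (s j) (lam j) := by
      intro n
      induction n with
      | zero =>
        intro i j hij
        have : j = i := Fin.ext (by simpa using hij)
        rw [this]
      | succ n ih =>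
        intro i j hij
        have hj := j.2
        exact (ih i ⟨i + n, by omega⟩ rfl).trans (h1 _ j (by simp; omega))
    have chain' : ∀ i j : Fin l, i ≤ j → abacus (s i) (lam i) ⊆ abacus (s j) (lam j) :=
      fun i j hij => chain (j - i : ℕ) i j (by have : (i : ℕ) ≤ j := hij; omega)
    have shift : ∀ i j : Fin l, abacus (s i) (lam i) ⊆ abacus (s j + e) (lam j) := by
      intro i j x hx
      rw [mem_abacus_add]
      have hi := i.2
      have a1 := chain' i ⟨l - 1, by omega⟩ (by show (i : ℕ) ≤ l - 1; omega) hx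
      have a2 := h2 ⟨l - 1, by omega⟩ ⟨0, by omega⟩ rfl rfl a1
      exact chain' ⟨0, by omega⟩ j (by show 0 ≤ (j : ℕ); omega) a2
    have mult : ∀ (n : ℕ) (i j : Fin l),
        abacus (s i) (lam i) ⊆ abacus (s j + ((n : ℤ) + 1) * e) (lam j) := by
      intro n
      induction n with
      | zero => intro i j; simpa using shift i j
      | succ n ih =>
        intro i j x hx
        have a1 := ih i j hx
        rw [mem_abacus_add] at a1
        have a2 := shift j j a1
        rw [mem_abacus_add] at a2 ⊢
        convert a2 using 1
        push_cast
        ring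
    intro i j k hk
    have he' : (2 : ℤ) ≤ e := by exact_mod_cast he
    have hle : s j - s i ≤ e := by
      rcases lt_trichotomy i j with h | h | h
      · exact (hs i j h).2
      · subst h; linarith
      · have := (hs j i h).1; linarith
    rcases lt_trichotomy k 0 with hk0 | hk0 | hk0
    · have hkm : k = -1 := by
        by_contra hne
        have : k ≤ -2 := by omega
        nlinarith
      subst hkm
      have heq : s j = s i + e := by linarith
      have a := shift j i
      rw [heq] at a
      have b := abacus_subset_symm _ _ _ a
      intro x hx
      rw [heq, mem_abacus_add]
      apply b
      rw [mem_abacus_add]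
      convert hx using 1
      ring
    · subst hk0
      simp only [zero_mul, add_zero] at hk ⊢
      rcases le_or_gt i j with h | h
      · exact chain' i j h
      · have h3 := (hs j i h).1
        have heq : s i = s j := by linarith
        have a := chain' j i h.le
        rw [heq] at a ⊢
        exact abacus_subset_symm _ _ _ a
    · have := mult (k - 1).toNat i j
      have h4 : (((k - 1).toNat : ℕ) : ℤ) + 1 = k := by omega
      rwa [h4] at this
  · intro h
    constructor
    · intro i j hij
      have h3 := (hs i j (by show (i : ℕ) < j; omega)).1
      simpa using h i j 0 (by linarith)
    · intro i j hi hj x hx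
      have hle : s i ≤ s j + 1 * (e : ℤ) := by
        rcases lt_trichotomy i j with h | h | h
        · have := (hs i j h).1
          have : (i : ℕ) < j := h
          omega
        · subst h; omega
        · have := (hs j i h).2; linarith
      have := h i j 1 hle hx
      rw [one_mul, mem_abacus_add] at this
      exact this

theorem ordFree_transfer (e : ℕ) {l : ℕ} (s s' : Fin l → ℤ) (lam lam' : Fin l → Ptn)
    (f : Fin l → Fin l) (c : Fin l → ℤ) (hs : ∀ i, s' i = s (f i) + c i * e)
    (hlam : ∀ i, lam' i = lam (f i)) (h : OrdFree e s lam) : OrdFree e s' lam' := by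
  intro i j k hk x hx
  rw [hs, hlam, mem_abacus_add] at hx
  rw [hs i, hs j] at hk
  have := h (f i) (f j) (c j + k - c i) (by linarith) hx
  rw [mem_abacus_add] at this
  rw [hs, hlam, add_assoc, mem_abacus_add]
  convert this using 1
  ring

/-- For `s ∈ 𝒜̄^l_e`, an `l`-partition is a reduced `(e,s)`-core
if and only if it is an `(e,s)`-core. -/
theorem stmt2 (e l : ℕ) (he : 2 ≤ e) (hl : 1 ≤ l) (s : Fin l → ℤ) (hs : Abar e s)
    (lam : Fin l → Ptn) : Complete e s lam ↔ IsCore e s lam := by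
  have he' : (e : ℤ) ≠ 0 := by omega
  have he'' : (0 : ℤ) < e := by omega
  have hs2 : Abar e (fun i => s (sigmaPerm e s i) % (e : ℤ)) := by
    intro i j hij
    have h1 := Tuple.monotone_sort (fun i => s i % (e : ℤ)) hij.le
    have h2 := Int.emod_nonneg (s (sigmaPerm e s i)) he'
    have h3 := Int.emod_lt_of_pos (s (sigmaPerm e s j)) he''
    simp only [Function.comp] at h1
    change s (sigmaPerm e s i) % (e : ℤ) ≤ s (sigmaPerm e s j) % (e : ℤ) at h1
    constructor
    · simpa using h1
    · dsimp only
      linarith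
  unfold IsCore
  rw [complete_iff_ordFree e l he hl s hs, complete_iff_ordFree e l he hl _ hs2]
  constructor
  · apply ordFree_transfer e _ _ _ _ (sigmaPerm e s) (fun i => -(s (sigmaPerm e s i) / e))
    · intro i
      have := Int.emod_add_mul_ediv (s (sigmaPerm e s i)) e
      linarith
    · intro i; rfl
  · apply ordFree_transfer e _ _ _ _ (sigmaPerm e s).symm (fun i => s i / e)
    · intro i
      have := Int.emod_add_mul_ediv (s i) e
      simp only [Equiv.apply_symm_apply]
      linarith
    · intro i; simp
end

section
/- Let e≥2 and s∈𝒜̄^l_e. Then the partition τ_{e,s}(∅,…,∅), the image under the Uglov map of the empty l-partition, is an e-core. -/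
/-- for `s ∈ 𝒜̄^l_e`, the image of the empty `l`-partition under the
Uglov map is an `e`-core. -/
theorem stmt5 (e l : ℕ) (he : 2 ≤ e) (hl : 1 ≤ l) (s : Fin l → ℤ) (hs : Abar e s)
    (mu : Ptn) (h : IsUglov e s (fun _ => Ptn.empty) mu) : IsECore e mu := by
  have key : ∀ (a x : ℤ), x ∈ abacus a Ptn.empty ↔ x < a := by
    intro a x
    constructor
    · rintro ⟨j, hj⟩
      simp only [Ptn.empty] at hj
      omega
    · intro hx
      refine ⟨(a - 1 - x).toNat, ?_⟩
      simp only [Ptn.empty]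
      omega
  have step : ∀ y ∈ uglovSet e s (fun _ => Ptn.empty),
      y - (e : ℤ) ∈ uglovSet e s (fun _ => Ptn.empty) := by
    rintro y ⟨c, q, r, hr, hm, rfl⟩
    rw [key] at hm
    by_cases hc : (c : ℕ) + 1 < l
    · refine ⟨⟨(c : ℕ) + 1, hc⟩, q, r, hr, ?_, ?_⟩
      · rw [key]
        have := (hs c ⟨(c : ℕ) + 1, hc⟩ (by simp [Fin.lt_def])).1
        linarith
      · push_cast
        ring
    · refine ⟨⟨0, hl⟩, q - 1, r, hr, ?_, ?_⟩
      · rw [key]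
        have h2 : s c - s ⟨0, hl⟩ ≤ (e : ℤ) := by
          rcases Nat.eq_zero_or_pos (c : ℕ) with h0 | h0
          · have : c = ⟨0, hl⟩ := Fin.ext h0
            rw [this]
            simp
          · exact (hs ⟨0, hl⟩ c (by simpa [Fin.lt_def] using h0)).2
        linarith
      · have h3 : ((c : ℕ) : ℤ) = (l : ℤ) - 1 := by
          have := c.isLt
          omega
        rw [h3]
        push_cast
        ring
  unfold IsUglov at h
  rw [← h] at step
  rintro x ⟨j, hj⟩
  obtain ⟨k, hk⟩ := step (x + ∑ i, s i) ⟨j, by rw [hj]; ring⟩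
  exact ⟨k, by linarith⟩
end

section
/- Let e≥2 and l≥1. The map τ^l_e sending a pair (𝛌,s), where s∈𝒜̄^l_e and 𝛌 is a reduced (e,s)-core, to the pair (τ_{e,s}(𝛌), s_1+…+s_l) is a bijection from {(𝛌,s) : s∈𝒜̄^l_e, 𝛌 a reduced (e,s)-core} onto {(λ,t) : t∈ℤ, λ an e-core partition}. -/
/-- `X` is a beta-set of charge `s`. -/
def HasCharge (X : Set ℤ) (s : ℤ) : Prop :=
  ∃ M : ℤ, ∀ N ≤ M, (∀ x < N, x ∈ X) ∧ (X ∩ Set.Ici N).Finite ∧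
    ((X ∩ Set.Ici N).ncard : ℤ) = s - N

theorem HasCharge.unique {X : Set ℤ} {s t : ℤ} (h : HasCharge X s) (h' : HasCharge X t) :
    s = t := by
  obtain ⟨M, hM⟩ := h
  obtain ⟨M', hM'⟩ := h'
  have a := (hM (min M M') (min_le_left _ _)).2.2
  have b := (hM' (min M M') (min_le_right _ _)).2.2
  omega

theorem HasCharge.mono {X Y : Set ℤ} {s t : ℤ} (h : HasCharge X s) (h' : HasCharge Y t)
    (hXY : X ⊆ Y) : s ≤ t := by
  obtain ⟨M, hM⟩ := h
  obtain ⟨M', hM'⟩ := h'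
  have a := (hM (min M M') (min_le_left _ _)).2.2
  obtain ⟨-, f, b⟩ := (hM' (min M M') (min_le_right _ _))
  have := Set.ncard_le_ncard (Set.inter_subset_inter_left (Set.Ici (min M M')) hXY) f
  omega

theorem HasCharge.of_one {X : Set ℤ} {s M : ℤ} (h1 : ∀ x < M, x ∈ X)
    (h2 : (X ∩ Set.Ici M).Finite) (h3 : ((X ∩ Set.Ici M).ncard : ℤ) = s - M) :
    HasCharge X s := by
  refine ⟨M, fun N hN => ?_⟩
  have e1 : X ∩ Set.Ici N = Set.Ico N M ∪ (X ∩ Set.Ici M) := by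
    ext x
    simp only [Set.mem_inter_iff, Set.mem_Ici, Set.mem_union, Set.mem_Ico]
    have := h1 x
    constructor
    · rintro ⟨a, b⟩
      by_cases c : x < M
      · exact Or.inl ⟨b, c⟩
      · exact Or.inr ⟨a, by omega⟩
    · rintro (⟨a, b⟩ | ⟨a, b⟩)
      · exact ⟨this b, a⟩
      · exact ⟨a, by omega⟩
  have hd : Disjoint (Set.Ico N M) (X ∩ Set.Ici M) := by
    rw [Set.disjoint_left]
    rintro x ⟨_, b⟩ ⟨_, c⟩
    simp only [Set.mem_Ici] at c
    omega
  have hc : (Set.Ico N M).ncard = (M - N).toNat := by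
    rw [← Finset.coe_Ico, Set.ncard_coe_finset, Int.card_Ico]
  refine ⟨fun x hx => h1 x (by omega), ?_, ?_⟩
  · rw [e1]
    exact (Set.finite_Ico N M).union h2
  · rw [e1, Set.ncard_union_eq hd (Set.finite_Ico N M) h2, hc]
    omega

theorem exists_charge {X : Set ℤ} {M B : ℤ} (h1 : ∀ x < M, x ∈ X) (h2 : ∀ x ∈ X, x ≤ B) :
    ∃ s, HasCharge X s :=
  ⟨((X ∩ Set.Ici M).ncard : ℤ) + M, HasCharge.of_one h1
    ((Set.finite_Icc M B).subset fun x hx => ⟨hx.2, h2 x hx.1⟩) (by ring)⟩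

theorem HasCharge.shift {X : Set ℤ} {s : ℤ} (h : HasCharge X s) (k : ℤ) :
    HasCharge {x | x - k ∈ X} (s + k) := by
  obtain ⟨M, hM⟩ := h
  obtain ⟨a, b, c⟩ := hM M le_rfl
  have e1 : {x | x - k ∈ X} ∩ Set.Ici (M + k) = (fun x => x + k) '' (X ∩ Set.Ici M) := by
    ext x
    simp only [Set.mem_inter_iff, Set.mem_setOf_eq, Set.mem_Ici, Set.mem_image]
    constructor
    · rintro ⟨u, v⟩
      exact ⟨x - k, ⟨u, by omega⟩, by omega⟩
    · rintro ⟨y, ⟨u, v⟩, rfl⟩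
      exact ⟨by simpa using u, by omega⟩
  apply HasCharge.of_one (M := M + k)
  · intro x hx
    exact a _ (by omega)
  · rw [e1]; exact b.image _
  · rw [e1, Set.ncard_image_of_injective _ (add_left_injective k)]
    omega

theorem HasCharge.bdd {X : Set ℤ} {s : ℤ} (h : HasCharge X s) :
    ∃ M B : ℤ, (∀ x < M, x ∈ X) ∧ ∀ x ∈ X, x ≤ B := by
  obtain ⟨M, hM⟩ := h
  obtain ⟨a, b, c⟩ := hM M le_rfl
  obtain ⟨B, hB⟩ := b.bddAbove
  refine ⟨M, max B M, a, fun x hx => ?_⟩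
  by_cases hxM : x < M
  · have := le_max_right B M
    omega
  · exact le_max_of_le_left (hB ⟨hx, by simpa using hxM⟩)

theorem bead_strict (s : ℤ) (lam : Ptn) :
    StrictMono (fun j : ℕ => -((lam.parts j : ℤ) - ((j : ℤ) + 1) + s)) := by
  intro i j hij
  have := lam.antitone' hij.le
  simp only
  omega

theorem abacus_charge (s : ℤ) (lam : Ptn) : HasCharge (abacus s lam) s := by
  obtain ⟨J, hJ⟩ := lam.eventually_zero
  have e1 : abacus s lam ∩ Set.Ici (s - J) =
      (fun j : ℕ => (lam.parts j : ℤ) - ((j : ℤ) + 1) + s) '' (Set.Iio J) := by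
    ext x
    simp only [Set.mem_inter_iff, Set.mem_Ici, Set.mem_image, Set.mem_Iio, abacus,
      Set.mem_setOf_eq]
    constructor
    · rintro ⟨⟨j, rfl⟩, h⟩
      refine ⟨j, ?_, rfl⟩
      by_contra hj
      have := hJ j (by omega)
      omega
    · rintro ⟨j, hj, rfl⟩
      exact ⟨⟨j, rfl⟩, by omega⟩
  have inj : Function.Injective (fun j : ℕ => (lam.parts j : ℤ) - ((j : ℤ) + 1) + s) := by
    intro i j hij
    apply (bead_strict s lam).injective
    simp only at hij ⊢
    omega
  apply HasCharge.of_one (M := s - J)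
  · intro x hx
    refine ⟨(s - 1 - x).toNat, ?_⟩
    rw [hJ _ (by omega)]
    omega
  · rw [e1]
    exact (Set.finite_Iio J).image _
  · rw [e1, Set.ncard_image_of_injective _ inj, ← Finset.coe_Iio, Set.ncard_coe_finset]
    simp

theorem abacus_inj {s t : ℤ} {lam mu : Ptn} (h : abacus s lam = abacus t mu) :
    s = t ∧ lam = mu := by
  have hs : s = t := (abacus_charge s lam).unique (h ▸ abacus_charge t mu)
  subst hs
  refine ⟨rfl, ?_⟩
  have hr := (StrictMono.range_inj (bead_strict s lam) (bead_strict s mu)).1 (by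
    ext x
    have := Set.ext_iff.1 h (-x)
    simp only [abacus, Set.mem_setOf_eq] at this
    simp only [Set.mem_range]
    constructor
    · rintro ⟨j, hj⟩
      obtain ⟨k, hk⟩ := this.1 ⟨j, by omega⟩
      exact ⟨k, by omega⟩
    · rintro ⟨j, hj⟩
      obtain ⟨k, hk⟩ := this.2 ⟨j, by omega⟩
      exact ⟨k, by omega⟩)
  have hp : lam.parts = mu.parts := by
    funext j
    have := congrFun hr j
    omega
  cases lam; cases mu
  simp only at hp
  subst hp
  rfl

theorem exists_ptn {X : Set ℤ} {s : ℤ} (h : HasCharge X s) : ∃ lam, abacus s lam = X := by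
  classical
  obtain ⟨M0, B, hM0, hB⟩ := h.bdd
  obtain ⟨M, hM⟩ := h
  set P : ℕ → Prop := fun n => B - n ∈ X with hP
  have hinf : (setOf P).Infinite := by
    apply Set.infinite_of_not_bddAbove
    rintro ⟨b, hb⟩
    have := hb (a := max (b + 1) (B - M0 + 1).toNat) (hM0 _ (by
      have := le_max_right (b+1) (B - M0 + 1).toNat
      omega))
    have := le_max_left (b+1) (B - M0 + 1).toNat
    omega
  have hmono : StrictMono (Nat.nth P) := Nat.nth_strictMono hinf
  have hcount : ∀ n : ℕ, B - n < M → (Nat.count P n : ℤ) = s - (B - n + 1) ∧ P n := by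
    intro n hn
    obtain ⟨-, f, c⟩ := hM (B - n + 1) (by omega)
    refine ⟨?_, (hM M le_rfl).1 _ hn⟩
    rw [← c, Nat.count_eq_card_filter_range, ← Set.ncard_coe_finset]
    congr 1
    rw [← Set.ncard_image_of_injective (f := fun n : ℕ => B - (n : ℤ)) _ (by
      intro a b hab
      simp only at hab
      omega)]
    congr 1
    ext x
    simp only [Finset.coe_filter, Finset.mem_range, Set.mem_image, Set.mem_setOf_eq,
      Set.mem_inter_iff, Set.mem_Ici, hP]
    constructor
    · rintro ⟨k, ⟨hk, hk'⟩, rfl⟩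
      exact ⟨hk', by omega⟩
    · rintro ⟨hx, hx'⟩
      have := hB x hx
      have e : B - ((B - x).toNat : ℤ) = x := by omega
      exact ⟨(B - x).toNat, ⟨by omega, by rw [e]; exact hx⟩, e⟩
  -- the signed parts
  set g : ℕ → ℤ := fun j => B - Nat.nth P j + j + 1 - s with hg
  have ganti : Antitone g := by
    apply antitone_nat_of_succ_le
    intro j
    have := hmono (Nat.lt_succ_self j)
    simp only [hg, Nat.succ_eq_add_one] at this ⊢
    push_cast
    omega
  have gz : ∃ J : ℕ, ∀ j, J ≤ j → g j = 0 := by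
    refine ⟨(s - M + 1).toNat + (s - B).toNat, fun j hj => ?_⟩
    have hn : B - ((B - s + 1 + j).toNat : ℤ) < M := by omega
    obtain ⟨a, b⟩ := hcount _ hn
    have hc : Nat.count P (B - s + 1 + j).toNat = j := by omega
    have := Nat.nth_count b
    rw [hc] at this
    simp only [hg, this]
    omega
  obtain ⟨J, hJ⟩ := gz
  have gnn : ∀ j, 0 ≤ g j := by
    intro j
    rw [← hJ (max J j) (le_max_left _ _)]
    exact ganti (le_max_right _ _)
  refine ⟨⟨fun j => (g j).toNat, fun i j hij => Int.toNat_le_toNat (ganti hij),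
    ⟨J, fun n hn => by simp [hJ n hn]⟩⟩, ?_⟩
  ext x
  simp only [abacus, Set.mem_setOf_eq]
  have key : ∀ j, ((g j).toNat : ℤ) - ((j : ℤ) + 1) + s = B - Nat.nth P j := by
    intro j
    have := gnn j
    simp only [hg] at this ⊢
    omega
  constructor
  · rintro ⟨j, rfl⟩
    rw [key]
    exact Nat.nth_mem_of_infinite hinf j
  · intro hx
    have := hB x hx
    have e : B - ((B - x).toNat : ℤ) = x := by omega
    have hPx : P (B - x).toNat := by simp only [hP]; rw [e]; exact hx
    refine ⟨Nat.count P (B - x).toNat, ?_⟩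
    rw [key, Nat.nth_count hPx, e]

/-- The Uglov relabelling of positions. -/
def phi (e l : ℕ) (c : Fin l) (x : ℤ) : ℤ :=
  ((l : ℤ) - 1 - ((c : ℕ) : ℤ)) * (e : ℤ) + (x / e) * (e : ℤ) * (l : ℤ) + x % e

theorem phi_eq (e l : ℕ) (he : 2 ≤ e) (c : Fin l) (q : ℤ) (r : ℕ) (hr : r < e) :
    phi e l c (q * e + r) =
      ((l : ℤ) - 1 - ((c : ℕ) : ℤ)) * (e : ℤ) + q * (e : ℤ) * (l : ℤ) + (r : ℤ) := by
  have h1 : (q * e + r) / (e : ℤ) = q := by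
    rw [add_comm, Int.add_mul_ediv_right _ _ (by omega), Int.ediv_eq_zero_of_lt (by omega) (by omega)]
    simp
  have h2 : (q * e + r) % (e : ℤ) = r := by
    rw [add_comm, Int.add_mul_emod_self_right, Int.emod_eq_of_lt (by omega) (by omega)]
  rw [phi, h1, h2]

theorem decomp (e : ℕ) (he : 2 ≤ e) (x : ℤ) : ∃ (q : ℤ) (r : ℕ), r < e ∧ x = q * e + r := by
  have a := Int.emod_nonneg x (b := e) (by omega)
  have b := Int.emod_lt_of_pos x (b := e) (by omega)
  have c := Int.emod_add_ediv_mul x e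
  exact ⟨x / e, (x % e).toNat, by omega, by omega⟩

theorem decomp_unique (e : ℕ) (he : 1 ≤ e) {q q' r r' : ℤ} (h0 : 0 ≤ r) (hr : r < e)
    (h0' : 0 ≤ r') (hr' : r' < e) (h : q * e + r = q' * e + r') : q = q' ∧ r = r' := by
  have h1 : ∀ q r : ℤ, 0 ≤ r → r < e → (q * e + r) / (e : ℤ) = q := by
    intro q r h h'
    rw [add_comm, Int.add_mul_ediv_right _ _ (by omega), Int.ediv_eq_zero_of_lt h h']
    simp
  have := h1 q r h0 hr
  rw [h, h1 q' r' h0' hr'] at this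
  subst this
  exact ⟨rfl, by omega⟩

theorem phi_surj (e l : ℕ) (he : 2 ≤ e) (hl : 1 ≤ l) (y : ℤ) : ∃ c x, phi e l c x = y := by
  obtain ⟨A, r, hr, rfl⟩ := decomp e he y
  have a := Int.emod_nonneg A (b := l) (by omega)
  have b := Int.emod_lt_of_pos A (b := l) (by omega)
  have c := Int.emod_add_ediv_mul A l
  refine ⟨⟨(l - 1 - A % l : ℤ).toNat, by omega⟩, (A / l) * e + r, ?_⟩
  rw [phi_eq e l he _ _ _ hr]
  have : (((l - 1 - A % l : ℤ).toNat : ℕ) : ℤ) = l - 1 - A % l := by omega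
  simp only [this]
  conv_rhs => rw [← c]
  ring

theorem phi_inj (e l : ℕ) (he : 2 ≤ e) {c c' : Fin l} {x x' : ℤ}
    (h : phi e l c x = phi e l c' x') : c = c' ∧ x = x' := by
  obtain ⟨q, r, hr, rfl⟩ := decomp e he x
  obtain ⟨q', r', hr', rfl⟩ := decomp e he x'
  rw [phi_eq e l he _ _ _ hr, phi_eq e l he _ _ _ hr'] at h
  have hc := c.2
  have hc' := c'.2
  obtain ⟨h1, h2⟩ := decomp_unique e (by omega) (q := q * l + (l - 1 - c)) (q' := q' * l + (l - 1 - c'))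
    (r := r) (r' := r') (by omega) (by omega) (by omega) (by omega) (by linarith)
  obtain ⟨h3, h4⟩ := decomp_unique l (by omega) (by omega) (by omega) (by omega) (by omega) h1
  refine ⟨Fin.ext (by omega), by rw [h3, h2]⟩

theorem phi_ge (e l : ℕ) (he : 2 ≤ e) (c : Fin l) (x K : ℤ) :
    K * e * l ≤ phi e l c x ↔ K * e ≤ x := by
  obtain ⟨q, r, hr, rfl⟩ := decomp e he x
  rw [phi_eq e l he _ _ _ hr]
  have hc := c.2
  have hr' : (r : ℤ) + 1 ≤ e := by omega
  have hl : (0 : ℤ) < l := by omega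
  have he' : (0 : ℤ) < e := by omega
  have hc' : (0 : ℤ) ≤ (l : ℤ) - 1 - c := by omega
  have hp := mul_pos he' hl
  constructor
  · intro h
    have : K ≤ q := by
      by_contra hk
      have : q + 1 ≤ K := by omega
      have := mul_le_mul_of_nonneg_right this hp.le
      have : (0 : ℤ) ≤ c * e := by positivity
      nlinarith
    nlinarith
  · intro h
    have : K ≤ q := by
      by_contra hk
      have : q + 1 ≤ K := by omega
      have := mul_le_mul_of_nonneg_right this he'.le
      nlinarith
    have := mul_le_mul_of_nonneg_right this hp.le
    have := mul_nonneg hc' he'.le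
    nlinarith

theorem phi_succ (e l : ℕ) (c c' : Fin l) (h : (c' : ℕ) = c + 1) (x : ℤ) :
    phi e l c x - e = phi e l c' x := by
  simp only [phi, h]
  push_cast
  ring

theorem phi_last (e l : ℕ) (he : 2 ≤ e) (c c' : Fin l) (h : (c : ℕ) = l - 1) (h' : (c' : ℕ) = 0)
    (x : ℤ) : phi e l c x - e = phi e l c' (x - e) := by
  obtain ⟨q, r, hr, rfl⟩ := decomp e he x
  have : q * e + r - e = (q - 1) * (e : ℤ) + r := by ring
  rw [this, phi_eq e l he _ _ _ hr, phi_eq e l he _ _ _ hr, h, h']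
  have := c.2
  have : ((l - 1 : ℕ) : ℤ) = l - 1 := by omega
  rw [this]
  push_cast
  ring

/-- Uglov set of a family of sets. -/
def uSet (e l : ℕ) (X : Fin l → Set ℤ) : Set ℤ := {y | ∃ c x, x ∈ X c ∧ y = phi e l c x}

theorem uglovSet_eq (e l : ℕ) (he : 2 ≤ e) (s : Fin l → ℤ) (lam : Fin l → Ptn) :
    uglovSet e s lam = uSet e l (fun c => abacus (s c) (lam c)) := by
  ext y
  constructor
  · rintro ⟨c, q, r, hr, hm, rfl⟩
    exact ⟨c, _, hm, (phi_eq e l he c q r hr).symm⟩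
  · rintro ⟨c, x, hm, rfl⟩
    obtain ⟨q, r, hr, rfl⟩ := decomp e he x
    exact ⟨c, q, r, hr, hm, phi_eq e l he c q r hr⟩

theorem phi_mem (e l : ℕ) (he : 2 ≤ e) (X : Fin l → Set ℤ) (c : Fin l) (x : ℤ) :
    phi e l c x ∈ uSet e l X ↔ x ∈ X c := by
  constructor
  · rintro ⟨c', x', hm, h⟩
    obtain ⟨rfl, rfl⟩ := phi_inj e l he h
    exact hm
  · intro h
    exact ⟨c, x, h, rfl⟩

theorem exists_low {ι : Type*} [Fintype ι] (e : ℕ) (he : 2 ≤ e) (M : ι → ℤ) :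
    ∃ K : ℤ, ∀ c, K * e ≤ M c := by
  obtain ⟨b, hb⟩ := (Set.finite_range M).bddBelow
  refine ⟨-|b|, fun c => ?_⟩
  have h1 : b ≤ M c := hb ⟨c, rfl⟩
  have h2 := neg_abs_le b
  have h3 := abs_nonneg b
  have h4 : (2 : ℤ) ≤ e := by exact_mod_cast he
  nlinarith

theorem uSet_charge (e l : ℕ) (he : 2 ≤ e) (hl : 1 ≤ l) (X : Fin l → Set ℤ) (s : Fin l → ℤ)
    (h : ∀ c, HasCharge (X c) (s c)) : HasCharge (uSet e l X) (∑ c, s c) := by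
  classical
  choose M hM using h
  obtain ⟨K, hK⟩ := exists_low e he M
  have f := fun c => (hM c _ (hK c)).2.1
  have hT : uSet e l X ∩ Set.Ici (K * e * l) =
      ((Finset.univ.sigma (fun c => (f c).toFinset)).image
        (fun p : (_ : Fin l) × ℤ => phi e l p.1 p.2) : Finset ℤ) := by
    ext y
    obtain ⟨c, x, rfl⟩ := phi_surj e l he hl y
    simp only [Set.mem_inter_iff, phi_mem e l he, Set.mem_Ici, phi_ge e l he, Finset.coe_image,
      Set.mem_image, Finset.mem_coe, Finset.mem_sigma, Finset.mem_univ, true_and,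
      Set.Finite.mem_toFinset]
    constructor
    · intro hx
      exact ⟨⟨c, x⟩, hx, rfl⟩
    · rintro ⟨⟨c', x'⟩, hx, hxy⟩
      obtain ⟨rfl, rfl⟩ := phi_inj e l he hxy
      exact hx
  apply HasCharge.of_one (M := K * e * l)
  · intro y hy
    obtain ⟨c, x, rfl⟩ := phi_surj e l he hl y
    rw [phi_mem e l he]
    apply (hM c _ (hK c)).1
    by_contra hx
    have := (phi_ge e l he c x K).2 (by omega)
    omega
  · rw [hT]
    exact Finset.finite_toSet _
  · rw [hT, Set.ncard_coe_finset, Finset.card_image_of_injective, Finset.card_sigma]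
    · push_cast
      have : ∀ c, (((f c).toFinset.card : ℕ) : ℤ) = s c - K * e := by
        intro c
        rw [← (hM c _ (hK c)).2.2, Set.ncard_eq_toFinset_card _ (f c)]
      simp only [this, Finset.sum_sub_distrib, Finset.sum_const, Finset.card_univ, Fintype.card_fin]
      simp only [nsmul_eq_mul]
      ring
    · rintro ⟨c, x⟩ ⟨c', x'⟩ hxy
      obtain ⟨rfl, rfl⟩ := phi_inj e l he hxy
      rfl

theorem uSet_surj (e l : ℕ) (he : 2 ≤ e) (hl : 1 ≤ l) (Y : Set ℤ) (t : ℤ) (h : HasCharge Y t) :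
    ∃ (s : Fin l → ℤ) (lam : Fin l → Ptn), uglovSet e s lam = Y ∧ ∑ c, s c = t := by
  obtain ⟨M, B, hM, hB⟩ := h.bdd
  set X : Fin l → Set ℤ := fun c => {x | phi e l c x ∈ Y} with hX
  have hY : uSet e l X = Y := by
    ext y
    obtain ⟨c, x, rfl⟩ := phi_surj e l he hl y
    rw [phi_mem e l he]
    rfl
  have hel : 2 ≤ e * l := by nlinarith
  have hc : ∀ c, ∃ s, HasCharge (X c) s := by
    intro c
    obtain ⟨K, hK⟩ := exists_low (e * l) hel (fun _ : Unit => M)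
    obtain ⟨K', hK'⟩ := exists_low (e * l) hel (fun _ : Unit => - (B + 1))
    have hK := hK ()
    have hK' := hK' ()
    push_cast at hK hK'
    apply exists_charge (M := K * e) (B := -K' * e)
    · intro x hx
      apply hM
      have := phi_ge e l he c x K
      rw [← not_le, ← this] at hx
      linarith
    · intro x hx
      by_contra hlt
      have := (phi_ge e l he c x (-K')).2 (by omega)
      have := hB _ hx
      linarith
  choose s hs using hc
  choose lam hlam using fun c => exists_ptn (hs c)
  refine ⟨s, lam, ?_, ?_⟩
  · rw [uglovSet_eq e l he]
    simp only [hlam]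
    exact hY
  · have := uSet_charge e l he hl X s hs
    rw [hY] at this
    exact this.unique h

theorem complete_iff (e l : ℕ) (he : 2 ≤ e) (hl : 1 ≤ l) (s : Fin l → ℤ) (lam : Fin l → Ptn) :
    Complete e s lam ↔ ∀ y ∈ uglovSet e s lam, y - (e : ℤ) ∈ uglovSet e s lam := by
  rw [uglovSet_eq e l he]
  constructor
  · rintro ⟨h1, h2⟩ y hy
    obtain ⟨c, x, rfl⟩ := phi_surj e l he hl y
    rw [phi_mem e l he] at hy
    by_cases hc : (c : ℕ) = l - 1
    · rw [phi_last e l he c ⟨0, hl⟩ hc rfl, phi_mem e l he]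
      exact h2 c ⟨0, hl⟩ hc rfl hy
    · rw [phi_succ e l c ⟨c + 1, by omega⟩ rfl, phi_mem e l he]
      exact h1 c ⟨c + 1, by omega⟩ rfl hy
  · intro h
    refine ⟨fun i j hij x hx => ?_, fun i j hi hj x hx => ?_⟩
    · have := h (phi e l i x) ((phi_mem e l he _ _ _).2 hx)
      rw [phi_succ e l i j hij, phi_mem e l he] at this
      exact this
    · have := h (phi e l i x) ((phi_mem e l he _ _ _).2 hx)
      rw [phi_last e l he i j hi hj, phi_mem e l he] at this
      exact this

theorem complete_abar (e l : ℕ) (s : Fin l → ℤ) (lam : Fin l → Ptn) (h : Complete e s lam) :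
    Abar e s := by
  obtain ⟨h1, h2⟩ := h
  have hmono : ∀ (k : ℕ) (i j : Fin l), (j : ℕ) = i + k → s i ≤ s j := by
    intro k
    induction k with
    | zero =>
      intro i j hij
      have : i = j := Fin.ext (by omega)
      rw [this]
    | succ k ih =>
      intro i j hij
      have := j.2
      have a := ih i ⟨i + k, by omega⟩ rfl
      have b := (abacus_charge _ _).mono (abacus_charge _ _) (h1 ⟨i + k, by omega⟩ j (by simp; omega))
      omega
  intro i j hij
  have hi := i.2
  have hj := j.2
  have hij' : (i : ℕ) < j := hij
  have a := hmono (j - i) i j (by omega)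
  have b := hmono i ⟨0, by omega⟩ i (by simp)
  have c := hmono (l - 1 - j) j ⟨l - 1, by omega⟩ (by simp; omega)
  have d := (abacus_charge _ _).mono ((abacus_charge _ _).shift e)
    (h2 ⟨l - 1, by omega⟩ ⟨0, by omega⟩ rfl rfl)
  omega

theorem ecore_iff (e : ℕ) (t : ℤ) (mu : Ptn) :
    IsECore e mu ↔ ∀ y ∈ abacus t mu, y - (e : ℤ) ∈ abacus t mu := by
  have key : ∀ y, y ∈ abacus t mu ↔ y - t ∈ abacus 0 mu := by
    intro y
    simp only [abacus, Set.mem_setOf_eq]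
    constructor
    · rintro ⟨j, hj⟩
      exact ⟨j, by omega⟩
    · rintro ⟨j, hj⟩
      exact ⟨j, by omega⟩
  constructor
  · intro h y hy
    rw [key] at hy ⊢
    have := h _ hy
    rwa [show y - e - t = y - t - e by ring]
  · intro h y hy
    have := h (y + t) ((key _).2 (by simpa using hy))
    rw [key] at this
    rwa [show y + t - e - t = y - e by ring] at this

theorem exists_uglov (e l : ℕ) (he : 2 ≤ e) (hl : 1 ≤ l) (s : Fin l → ℤ) (lam : Fin l → Ptn) :
    ∃ mu, IsUglov e s lam mu := by
  unfold IsUglov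
  rw [uglovSet_eq e l he]
  exact exists_ptn (uSet_charge e l he hl _ s fun c => abacus_charge _ _)

/-- the map `(𝛌,s) ↦ (τ_{e,s}(𝛌), s_1+…+s_l)` is a bijection from
pairs of a multicharge `s ∈ 𝒜̄^l_e` and a reduced `(e,s)`-core onto pairs of an
integer and an `e`-core partition. -/
theorem stmt7 (e l : ℕ) (he : 2 ≤ e) (hl : 1 ≤ l) :
    ∃ F : {p : (Fin l → Ptn) × (Fin l → ℤ) // Abar e p.2 ∧ Complete e p.2 p.1} →
        {q : Ptn × ℤ // IsECore e q.1},
      Function.Bijective F ∧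
      ∀ x, IsUglov e x.1.2 x.1.1 (F x).1.1 ∧ (F x).1.2 = ∑ i, x.1.2 i := by
  choose T hT using exists_uglov e l he hl
  refine ⟨fun p => ⟨(T p.1.2 p.1.1, ∑ i, p.1.2 i), ?_⟩, ⟨?_, ?_⟩, fun x => ⟨hT _ _, rfl⟩⟩
  · have h := (complete_iff e l he hl _ _).1 p.2.2
    rw [← hT] at h
    exact (ecore_iff e _ _).2 h
  · rintro ⟨⟨lam, s⟩, h⟩ ⟨⟨lam', s'⟩, h'⟩ heq
    simp only [Subtype.mk.injEq, Prod.mk.injEq] at heq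
    obtain ⟨h1, h2⟩ := heq
    have hU : uglovSet e s lam = uglovSet e s' lam' := by
      rw [← hT, ← hT, h1, h2]
    rw [uglovSet_eq e l he, uglovSet_eq e l he] at hU
    have hc : ∀ c, s c = s' c ∧ lam c = lam' c := by
      intro c
      apply abacus_inj
      ext x
      have := Set.ext_iff.1 hU (phi e l c x)
      rwa [phi_mem e l he, phi_mem e l he] at this
    have hs : s = s' := funext fun c => (hc c).1
    have hlam : lam = lam' := funext fun c => (hc c).2
    subst hs hlam
    rfl
  · rintro ⟨⟨mu, t⟩, hmu⟩
    obtain ⟨s, lam, hU, hs⟩ := uSet_surj e l he hl _ t (abacus_charge t mu)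
    have hC : Complete e s lam := by
      rw [complete_iff e l he hl, hU]
      exact (ecore_iff e t mu).1 hmu
    refine ⟨⟨(lam, s), complete_abar e l s lam hC, hC⟩, ?_⟩
    have := hT s lam
    unfold IsUglov at this
    rw [hU] at this
    have hm := (abacus_inj this).2
    simp only [Subtype.mk.injEq, Prod.mk.injEq]
    exact ⟨hm, hs⟩
end

section
/- Let e≥2, s∈𝒜̄^l_e and t=s_1+…+s_l. For all l-partitions 𝛌 and 𝛍, one has C_{e,(t)}(τ_{e,s}(𝛌)) = C_{e,(t)}(τ_{e,s}(𝛍)) if and only if C_{e,s}(𝛌) = C_{e,s}(𝛍). -/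
/-- floor function counting integers congruent to `i` -/
def FF (e : ℕ) (i : ZMod e) (y : ℤ) : ℤ := (y - (i.val : ℤ)) / (e : ℤ)

lemma FF_step (e : ℕ) (he : 2 ≤ e) (i : ZMod e) (y : ℤ) :
    FF e i y = FF e i (y - 1) + if ((y : ℤ) : ZMod e) = i then 1 else 0 := by
  have : NeZero e := ⟨by omega⟩
  have key : ((y : ℤ) : ZMod e) = i ↔ (e : ℤ) ∣ y - (i.val : ℤ) := by
    rw [← ZMod.intCast_zmod_eq_zero_iff_dvd]
    push_cast
    rw [ZMod.natCast_zmod_val, sub_eq_zero]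
  unfold FF
  have e0 : (0 : ℤ) < e := by omega
  rw [show y - 1 - (i.val : ℤ) = (y - (i.val : ℤ)) - 1 by ring]
  generalize y - (i.val : ℤ) = z at *
  split_ifs with h
  · obtain ⟨k, rfl⟩ := key.1 h
    rw [Int.mul_ediv_cancel_left _ e0.ne']
    have : ((e : ℤ) * k - 1) / e = k - 1 := by
      rw [Int.ediv_eq_iff_of_pos e0]
      constructor <;> nlinarith
    omega
  · have h' := mt key.2 h
    rw [add_zero]
    have h1 := Int.emod_add_mul_ediv z e
    have h2 := Int.emod_nonneg z e0.ne'
    have h3 := Int.emod_lt_of_pos z e0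
    have h4 : z % e ≠ 0 := fun h => h' (Int.dvd_of_emod_eq_zero h)
    symm
    rw [Int.ediv_eq_iff_of_pos e0]
    have h5 : 1 ≤ z % e := by omega
    constructor <;> nlinarith

lemma row_card (e : ℕ) (he : 2 ≤ e) (i : ZMod e) (u : ℤ) (m : ℕ) :
    (((Finset.range m).filter (fun b : ℕ => (((b : ℤ) + u : ℤ) : ZMod e) = i)).card : ℤ)
      = FF e i ((m : ℤ) + u - 1) - FF e i (u - 1) := by
  induction m with
  | zero => simp
  | succ m ih =>
    rw [Finset.range_add_one, Finset.filter_insert]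
    have := FF_step e he i ((m : ℤ) + u)
    have h2 : ((m + 1 : ℕ) : ℤ) + u - 1 = (m : ℤ) + u := by push_cast; ring
    rw [h2, this]
    split_ifs with h
    · rw [Finset.card_insert_of_notMem (by simp)]
      rw [Nat.cast_add, Nat.cast_one, ih]; ring
    · rw [ih]; ring

lemma resCount_eq (e : ℕ) (he : 2 ≤ e) {l : ℕ} (s : Fin l → ℤ) (lam : Fin l → Ptn)
    (n : Fin l → ℕ) (hn : ∀ c j, n c ≤ j → (lam c).parts j = 0) (i : ZMod e) :
    (resCount e s lam i : ℤ) =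
      ∑ c, ∑ j ∈ Finset.range (n c),
        (FF e i (((lam c).parts j : ℤ) - ((j : ℤ) + 1) + s c) - FF e i (s c - (j : ℤ) - 1)) := by
  classical
  let S : Finset ((_ : Fin l) × (_ : ℕ) × ℕ) :=
    Finset.univ.sigma fun c => (Finset.range (n c)).sigma fun j =>
      (Finset.range ((lam c).parts j)).filter
        (fun b : ℕ => (((b : ℤ) + (s c - (j : ℤ)) : ℤ) : ZMod e) = i)
  let f : ((_ : Fin l) × (_ : ℕ) × ℕ) → ℕ × ℕ × Fin l := fun x => (x.2.1, x.2.2, x.1)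
  have hf : Function.Injective f := by
    rintro ⟨a, b, c⟩ ⟨a', b', c'⟩ h
    simp only [f, Prod.mk.injEq] at h
    obtain ⟨rfl, rfl, rfl⟩ := h
    rfl
  have hset : {x ∈ diag lam | res e s x = i} = ((S.image f : Finset _) : Set (ℕ × ℕ × Fin l)) := by
    ext ⟨a, b, c⟩
    simp only [Finset.coe_image, Set.mem_image, Finset.mem_coe, S, f, Finset.mem_sigma,
      Finset.mem_filter, Finset.mem_range, Finset.mem_univ, true_and, diag, res, Set.mem_ofPred_eq]
    constructor
    · rintro ⟨h1, h2⟩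
      refine ⟨⟨c, a, b⟩, ⟨?_, h1, ?_⟩, rfl⟩
      · by_contra hc
        have := hn c a (by simpa using hc)
        omega
      · rw [← h2]; congr 1; ring
    · rintro ⟨⟨c', a', b'⟩, ⟨h0, h1, h2⟩, h⟩
      simp only [Prod.mk.injEq] at h
      obtain ⟨rfl, rfl, rfl⟩ := h
      refine ⟨h1, ?_⟩
      rw [← h2]; congr 1; ring
  unfold resCount
  rw [hset, Set.ncard_coe_finset, Finset.card_image_of_injective _ hf]
  simp only [S, Finset.card_sigma, Nat.cast_sum]
  refine Finset.sum_congr rfl fun c _ => Finset.sum_congr rfl fun j _ => ?_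
  rw [row_card e he]
  congr 2
  ring

lemma beta_inj (lam : Ptn) (t : ℤ) : Function.Injective
    (fun j : ℕ => (lam.parts j : ℤ) - ((j : ℤ) + 1) + t) := by
  intro a b h
  simp only at h
  rcases lt_trichotomy a b with hab | hab | hab
  · have := lam.antitone' hab.le; omega
  · exact hab
  · have := lam.antitone' hab.le; omega

/-- beads coming from the first `n` parts -/
def beads (lam : Ptn) (t : ℤ) (n : ℕ) : Finset ℤ :=
  (Finset.range n).image (fun j : ℕ => (lam.parts j : ℤ) - ((j : ℤ) + 1) + t)

lemma sum_beads (lam : Ptn) (t : ℤ) (n : ℕ) (g : ℤ → ℤ) :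
    ∑ x ∈ beads lam t n, g x =
      ∑ j ∈ Finset.range n, g ((lam.parts j : ℤ) - ((j : ℤ) + 1) + t) := by
  unfold beads
  rw [Finset.sum_image (fun a _ b _ h => beta_inj lam t h)]

lemma mem_beads (lam : Ptn) (t : ℤ) (n : ℕ) (hn : ∀ j, n ≤ j → lam.parts j = 0) (x : ℤ) :
    x ∈ beads lam t n ↔ x ∈ abacus t lam ∧ t - n ≤ x := by
  simp only [beads, Finset.mem_image, Finset.mem_range, abacus, Set.mem_ofPred_eq]
  constructor
  · rintro ⟨j, hj, rfl⟩
    exact ⟨⟨j, rfl⟩, by omega⟩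
  · rintro ⟨⟨j, rfl⟩, h⟩
    refine ⟨j, ?_, rfl⟩
    by_contra hc
    have := hn j (by omega)
    omega

/-- the Uglov position map -/
def upos (e l : ℕ) (c : Fin l) (x : ℤ) : ℤ :=
  ((l : ℤ) - 1 - ((c : ℕ) : ℤ)) * (e : ℤ) + (x / e) * (e : ℤ) * (l : ℤ) + x % e

lemma FF_upos (e l : ℕ) (he : 2 ≤ e) (i : ZMod e) (c : Fin l) (x : ℤ) :
    FF e i (upos e l c x) =
      ((l : ℤ) - 1 - ((c : ℕ) : ℤ)) + ((l : ℤ) - 1) * FF e 0 x + FF e i x := by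
  have e0 : (e : ℤ) ≠ 0 := by omega
  have h1 := Int.emod_add_mul_ediv x e
  unfold FF upos
  rw [show ((l : ℤ) - 1 - ((c : ℕ) : ℤ)) * (e : ℤ) + (x / e) * (e : ℤ) * (l : ℤ) + x % e - i.val
    = (x % e - i.val) + e * ((l : ℤ) - 1 - ((c : ℕ) : ℤ) + (x / e) * l) by ring,
    Int.add_mul_ediv_left _ _ e0]
  have h2 : (x - i.val) / (e : ℤ) = (x % e - i.val) / e + x / e := by
    rw [← Int.add_mul_ediv_left _ _ e0]
    congr 1
    linarith
  rw [h2]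
  simp
  ring

lemma mem_uglovSet (e l : ℕ) (he : 2 ≤ e) (s : Fin l → ℤ) (lam : Fin l → Ptn) (y : ℤ) :
    y ∈ uglovSet e s lam ↔ ∃ c, ∃ x ∈ abacus (s c) (lam c), upos e l c x = y := by
  have e0 : (0 : ℤ) < e := by omega
  constructor
  · rintro ⟨c, q, r, hr, hx, rfl⟩
    refine ⟨c, _, hx, ?_⟩
    have h1 : (q * (e : ℤ) + r) / e = q := by
      rw [Int.ediv_eq_iff_of_pos e0]; constructor <;> nlinarith
    have h2 := Int.emod_add_mul_ediv (q * (e : ℤ) + r) e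
    rw [h1] at h2
    unfold upos
    rw [h1]
    linarith
  · rintro ⟨c, x, hx, rfl⟩
    have h1 := Int.emod_add_mul_ediv x e
    have h2 := Int.emod_nonneg x e0.ne'
    have h3 := Int.emod_lt_of_pos x e0
    refine ⟨c, x / e, (x % e).toNat, by omega, ?_, ?_⟩
    · rw [Int.toNat_of_nonneg h2]
      convert hx using 1
      linarith
    · rw [Int.toNat_of_nonneg h2]; rfl

lemma upos_ge (e l : ℕ) (he : 2 ≤ e) (c : Fin l) (x K : ℤ) :
    K * e * l ≤ upos e l c x ↔ K * e ≤ x := by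
  have e0 : (0 : ℤ) < e := by omega
  have h1 := Int.emod_add_mul_ediv x e
  have h2 := Int.emod_nonneg x e0.ne'
  have h3 := Int.emod_lt_of_pos x e0
  have hc : ((c : ℕ) : ℤ) + 1 ≤ l := by have := c.2; omega
  have hc0 : (0 : ℤ) ≤ ((c : ℕ) : ℤ) := by omega
  have hl : (0 : ℤ) < l := by omega
  rw [← Int.le_ediv_iff_mul_le e0]
  unfold upos
  generalize x / (e : ℤ) = q at *
  generalize x % (e : ℤ) = r at *
  generalize ((c : ℕ) : ℤ) = d at *
  constructor
  · intro h
    by_contra hk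
    have hk : q + 1 ≤ K := by omega
    have : (q + 1) * (e * l) ≤ K * ((e : ℤ) * l) := mul_le_mul_of_nonneg_right hk (by positivity)
    nlinarith
  · intro h
    have : K * ((e : ℤ) * l) ≤ q * (e * l) := mul_le_mul_of_nonneg_right h (by positivity)
    have : 0 ≤ ((l : ℤ) - 1 - d) * e := mul_nonneg (by omega) e0.le
    nlinarith

lemma upos_inj (e l : ℕ) (he : 2 ≤ e) (c c' : Fin l) (x x' : ℤ)
    (h : upos e l c x = upos e l c' x') : c = c' ∧ x = x' := by
  have e0 : (0 : ℤ) < e := by omega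
  have h1 := Int.emod_add_mul_ediv x e
  have h2 := Int.emod_nonneg x e0.ne'
  have h3 := Int.emod_lt_of_pos x e0
  have h1' := Int.emod_add_mul_ediv x' e
  have h2' := Int.emod_nonneg x' e0.ne'
  have h3' := Int.emod_lt_of_pos x' e0
  have hc := c.2
  have hc' := c'.2
  have A : ∀ (q : ℤ) (r : ℤ) (d : ℕ), 0 ≤ r → r < e → d < l →
      (((l : ℤ) - 1 - d) * (e : ℤ) + q * (e : ℤ) * (l : ℤ) + r) % e = r ∧
      (((l : ℤ) - 1 - d) * (e : ℤ) + q * (e : ℤ) * (l : ℤ) + r) / e = ((l : ℤ) - 1 - d) + l * q ∧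
      (((l : ℤ) - 1 - d) + l * q) / l = q := by
    intro q r d h0 h1 h2
    rw [show ((l : ℤ) - 1 - d) * (e : ℤ) + q * (e : ℤ) * (l : ℤ) + r
      = r + e * (((l : ℤ) - 1 - d) + l * q) by ring]
    refine ⟨?_, ?_, ?_⟩
    · rw [Int.add_mul_emod_self_left, Int.emod_eq_of_lt h0 h1]
    · rw [Int.add_mul_ediv_left _ _ e0.ne', Int.ediv_eq_zero_of_lt h0 h1, zero_add]
    · rw [Int.add_mul_ediv_left _ _ (by omega), Int.ediv_eq_zero_of_lt (by omega) (by omega),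
        zero_add]
  obtain ⟨a1, a2, a3⟩ := A (x / e) (x % e) c h2 h3 hc
  obtain ⟨b1, b2, b3⟩ := A (x' / e) (x' % e) c' h2' h3' hc'
  unfold upos at h
  rw [h] at a1 a2
  have hr : x % e = x' % e := a1.symm.trans b1
  have hq0 := a2.symm.trans b2
  have hq : x / e = x' / e := by rw [← a3, ← b3, hq0]
  rw [hq] at hq0
  refine ⟨Fin.ext (by omega), ?_⟩
  rw [← h1, ← h1', hr, hq]

lemma sum_uglov (e l : ℕ) (he : 2 ≤ e) (s : Fin l → ℤ) (lam : Fin l → Ptn) (tlam : Ptn)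
    (h : IsUglov e s lam tlam) (K : ℤ) (n : Fin l → ℕ) (m : ℕ)
    (hn : ∀ c j, n c ≤ j → (lam c).parts j = 0) (hm : ∀ j, m ≤ j → tlam.parts j = 0)
    (hnK : ∀ c, s c - n c = K * e) (hmK : (∑ c, s c) - m = K * e * l) (g : ℤ → ℤ) :
    ∑ y ∈ beads tlam (∑ c, s c) m, g y =
      ∑ c, ∑ x ∈ beads (lam c) (s c) (n c), g (upos e l c x) := by
  rw [Finset.sum_sigma' Finset.univ (fun c => beads (lam c) (s c) (n c))
    (fun c x => g (upos e l c x))]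
  symm
  refine Finset.sum_nbij (fun p => upos e l p.1 p.2) ?_ ?_ ?_ (fun _ _ => rfl)
  · rintro ⟨c, x⟩ hx
    simp only [Finset.mem_sigma, Finset.mem_univ, true_and] at hx
    rw [mem_beads _ _ _ (hn c), hnK] at hx
    rw [mem_beads _ _ _ hm, hmK, h, mem_uglovSet e l he]
    exact ⟨⟨c, x, hx.1, rfl⟩, (upos_ge e l he c x K).2 hx.2⟩
  · rintro ⟨c, x⟩ _ ⟨c', x'⟩ _ hh
    obtain ⟨rfl, rfl⟩ := upos_inj e l he c c' x x' hh
    rfl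
  · intro y hy
    rw [Finset.mem_coe, mem_beads _ _ _ hm, hmK, h, mem_uglovSet e l he] at hy
    obtain ⟨⟨c, x, hx, rfl⟩, hy⟩ := hy
    refine ⟨⟨c, x⟩, ?_, rfl⟩
    simp only [Finset.coe_sigma, Set.mem_sigma_iff, Finset.mem_coe, Finset.mem_univ, true_and]
    rw [mem_beads _ _ _ (hn c), hnK]
    exact ⟨hx, (upos_ge e l he c x K).1 hy⟩

lemma uglov_count (e l : ℕ) (he : 2 ≤ e) (s : Fin l → ℤ) (K : ℤ) (n : Fin l → ℕ) (m : ℕ)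
    (hnK : ∀ c, s c - n c = K * e) (hmK : (∑ c, s c) - m = K * e * l) (i : ZMod e) :
    ∃ C : ℤ, ∀ (lam : Fin l → Ptn) (tlam : Ptn), IsUglov e s lam tlam →
      (∀ c j, n c ≤ j → (lam c).parts j = 0) → (∀ j, m ≤ j → tlam.parts j = 0) →
      (resCount₁ e (∑ k, s k) tlam i : ℤ) =
        C + ((l : ℤ) - 1) * resCount e s lam 0 + resCount e s lam i := by
  refine ⟨(∑ c : Fin l, ∑ j ∈ Finset.range (n c), (((l : ℤ) - 1 - ((c : ℕ) : ℤ)) +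
      ((l : ℤ) - 1) * FF e 0 (s c - (j : ℤ) - 1) + FF e i (s c - (j : ℤ) - 1)))
      - ∑ j ∈ Finset.range m, FF e i ((∑ k, s k) - (j : ℤ) - 1), ?_⟩
  intro lam tlam h hn hm
  have hu := sum_uglov e l he s lam tlam h K n m hn hm hnK hmK (FF e i)
  simp only [sum_beads, FF_upos e l he] at hu
  unfold resCount₁
  rw [resCount_eq e he _ _ (fun _ => m) (fun _ => hm), resCount_eq e he s lam n hn,
    resCount_eq e he s lam n hn]
  simp only [Finset.univ_unique, Finset.sum_singleton, Finset.sum_sub_distrib,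
    Finset.sum_add_distrib, ← Finset.mul_sum] at hu ⊢
  rw [hu]
  ring

lemma exists_bound (lam : Ptn) (s : ℤ) : ∃ B : ℕ, ∀ k : ℤ, (B : ℤ) ≤ k →
    0 ≤ s + k ∧ ∀ j : ℕ, s + k ≤ j → lam.parts j = 0 := by
  obtain ⟨N, hN⟩ := lam.eventually_zero
  exact ⟨N + s.natAbs, fun k hk => ⟨by omega, fun j hj => hN j (by omega)⟩⟩

/-- two `l`-partitions have the same multiset of residues if and only if
their images under the Uglov map do. -/
theorem stmt9 (e l : ℕ) (he : 2 ≤ e) (hl : 1 ≤ l) (s : Fin l → ℤ) (hs : Abar e s)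
    (lam mu : Fin l → Ptn) (tlam tmu : Ptn)
    (h1 : IsUglov e s lam tlam) (h2 : IsUglov e s mu tmu) :
    (∀ i : ZMod e, resCount₁ e (∑ k, s k) tlam i = resCount₁ e (∑ k, s k) tmu i) ↔
      (∀ i : ZMod e, resCount e s lam i = resCount e s mu i) := by
  choose B1 hB1 using fun c => exists_bound (lam c) (s c)
  choose B2 hB2 using fun c => exists_bound (mu c) (s c)
  obtain ⟨B3, hB3⟩ := exists_bound tlam (∑ k, s k)
  obtain ⟨B4, hB4⟩ := exists_bound tmu (∑ k, s k)
  let B : ℕ := ∑ c, B1 c + ∑ c, B2 c + B3 + B4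
  have b1 : ∀ c, B1 c ≤ B := fun c => by
    have := Finset.single_le_sum (f := B1) (fun _ _ => Nat.zero_le _) (Finset.mem_univ c)
    omega
  have b2 : ∀ c, B2 c ≤ B := fun c => by
    have := Finset.single_le_sum (f := B2) (fun _ _ => Nat.zero_le _) (Finset.mem_univ c)
    omega
  have hBe : B ≤ B * e := Nat.le_mul_of_pos_right _ (by omega)
  have hBel : B ≤ B * e * l := hBe.trans (Nat.le_mul_of_pos_right _ (by omega))
  have c1 := fun c => hB1 c ((B * e : ℕ) : ℤ) (by have := b1 c; omega)
  have c2 := fun c => hB2 c ((B * e : ℕ) : ℤ) (by have := b2 c; omega)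
  have c3 := hB3 ((B * e * l : ℕ) : ℤ) (by omega)
  have c4 := hB4 ((B * e * l : ℕ) : ℤ) (by omega)
  have hn : ∀ c, (((s c + ((B * e : ℕ) : ℤ)).toNat : ℕ) : ℤ) = s c + ((B * e : ℕ) : ℤ) :=
    fun c => Int.toNat_of_nonneg (c1 c).1
  have hm := Int.toNat_of_nonneg c3.1
  have key := fun i => uglov_count e l he s (-(B : ℤ))
    (fun c => (s c + ((B * e : ℕ) : ℤ)).toNat) ((∑ k, s k) + ((B * e * l : ℕ) : ℤ)).toNat
    (fun c => by rw [hn]; push_cast; ring) (by rw [hm]; push_cast; ring) i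
  have key2 : ∀ i, (resCount₁ e (∑ k, s k) tlam i : ℤ) - resCount₁ e (∑ k, s k) tmu i =
      ((l : ℤ) - 1) * ((resCount e s lam 0 : ℤ) - resCount e s mu 0)
        + ((resCount e s lam i : ℤ) - resCount e s mu i) := by
    intro i
    obtain ⟨C, hC⟩ := key i
    rw [hC lam tlam h1 (fun c j hj => (c1 c).2 j (by have := hn c; omega))
        (fun j hj => c3.2 j (by omega)),
      hC mu tmu h2 (fun c j hj => (c2 c).2 j (by have := hn c; omega))
        (fun j hj => c4.2 j (by omega))]
    ring
  constructor
  · intro h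
    have h0 : (resCount e s lam 0 : ℤ) - resCount e s mu 0 = 0 := by
      have := key2 0
      rw [h 0, sub_self] at this
      have h' : (l : ℤ) * ((resCount e s lam 0 : ℤ) - resCount e s mu 0) = 0 := by linarith
      exact (mul_eq_zero.1 h').resolve_left (by omega)
    intro i
    have := key2 i
    rw [h i, h0] at this
    simp only [sub_self, mul_zero, zero_add] at this
    omega
  · intro h i
    have := key2 i
    rw [h i, h 0] at this
    simp only [sub_self, mul_zero, zero_add] at this
    omega
end

section
/- Let e≥2, s∈𝒜̄^l_e, t=s_1+…+s_l, and let 𝛌 be any l-partition. For every i∈ℤ/eℤ: if i≠0 then M^s_i(𝛌) = M^{(t)}_i(τ_{e,s}(𝛌)), and M^s_0(𝛌) = M^{(t)}_0(τ_{e,s}(𝛌)) + l − 1. -/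
lemma addable_iff {l : ℕ} (lam : Fin l → Ptn) (a b : ℕ) (c : Fin l) :
    Addable lam (a, b, c) ↔
      b = (lam c).parts a ∧ (∀ a', a' < a → (lam c).parts a < (lam c).parts a') := by
  constructor
  · rintro ⟨h1, mu, hmu⟩
    have key : ∀ a' b', b' < (mu c).parts a' ↔ (b' < (lam c).parts a' ∨ (a' = a ∧ b' = b)) := by
      intro a' b'
      have := Set.ext_iff.1 hmu (a', b', c)
      simpa [diag, or_comm] using this
    have h1' : (lam c).parts a ≤ b := by simpa [diag] using h1
    have hb : b < (mu c).parts a := (key a b).2 (Or.inr ⟨rfl, rfl⟩)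
    have hb2 : b ≤ (lam c).parts a := by
      by_contra hlt
      push Not at hlt
      have := (key a ((lam c).parts a)).1 (by omega)
      omega
    refine ⟨by omega, fun a' ha' => ?_⟩
    have := (mu c).antitone' ha'.le
    have := (key a' b).1 (by omega)
    omega
  · rintro ⟨rfl, h⟩
    refine ⟨by simp [diag], fun c' => if hc : c' = c then
      ⟨fun j => if j = a then (lam c).parts a + 1 else (lam c).parts j, ?_, ?_⟩ else lam c', ?_⟩
    · intro i j hij
      have h1 := (lam c).antitone' hij
      have h2 := h i
      split_ifs with h3 h4 h4
      · rfl
      · subst h3; have := h2 (by omega); omega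
      · subst h4; omega
      · exact h1
    · obtain ⟨N, hN⟩ := (lam c).eventually_zero
      refine ⟨max N (a + 1), fun n hn => ?_⟩
      have h1 : N ≤ n := le_trans (le_max_left _ _) hn
      have h2 : a + 1 ≤ n := le_trans (le_max_right _ _) hn
      rw [if_neg (by omega)]
      exact hN n h1
    · ext ⟨a', b', c'⟩
      simp only [diag, Set.mem_ofPred_eq, Set.union_singleton, Set.mem_insert_iff, Prod.mk.injEq]
      by_cases hc : c' = c
      · subst hc
        simp only [dite_true]
        split_ifs with h3
        · subst h3; simp; omega
        · simp [h3]
      · simp [hc]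

lemma removable_iff {l : ℕ} (lam : Fin l → Ptn) (a b : ℕ) (c : Fin l) :
    Removable lam (a, b, c) ↔
      b + 1 = (lam c).parts a ∧ (∀ a', a < a' → (lam c).parts a' < (lam c).parts a) := by
  constructor
  · rintro ⟨h1, mu, hmu⟩
    have key : ∀ a' b', b' < (mu c).parts a' ↔ (b' < (lam c).parts a' ∧ ¬ (a' = a ∧ b' = b)) := by
      intro a' b'
      have := Set.ext_iff.1 hmu (a', b', c)
      simpa [diag] using this
    have h1' : b < (lam c).parts a := by simpa [diag] using h1
    have hb : ¬ b < (mu c).parts a := fun h => ((key a b).1 h).2 ⟨rfl, rfl⟩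
    have hb2 : ¬ b + 1 < (lam c).parts a := by
      intro hlt
      have := (key a (b + 1)).2 ⟨hlt, by omega⟩
      omega
    refine ⟨by omega, fun a' ha' => ?_⟩
    have := (mu c).antitone' ha'.le
    by_contra hlt
    have := (key a' b).2 ⟨by omega, by omega⟩
    omega
  · rintro ⟨hb, h⟩
    refine ⟨by simp [diag]; omega, fun c' => if hc : c' = c then
      ⟨fun j => if j = a then b else (lam c).parts j, ?_, ?_⟩ else lam c', ?_⟩
    · intro i j hij
      have h1 := (lam c).antitone' hij
      have h2 := h j
      split_ifs with h3 h4 h4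
      · rfl
      · subst h3; omega
      · subst h4; have := h2 (by omega); omega
      · exact h1
    · obtain ⟨N, hN⟩ := (lam c).eventually_zero
      refine ⟨max N (a + 1), fun n hn => ?_⟩
      have h1 : N ≤ n := le_trans (le_max_left _ _) hn
      have h2 : a + 1 ≤ n := le_trans (le_max_right _ _) hn
      rw [if_neg (by omega)]
      exact hN n h1
    · ext ⟨a', b', c'⟩
      simp only [diag, Set.mem_ofPred_eq, Set.mem_sdiff, Set.mem_singleton_iff, Prod.mk.injEq]
      by_cases hc : c' = c
      · subst hc
        simp only [dite_true]
        split_ifs with h3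
        · subst h3; simp; omega
        · simp [h3]
      · simp [hc]

lemma abacus_bounds (t : ℤ) (lam : Ptn) :
    ∃ N : ℤ, (∀ x, x < -N → x ∈ abacus t lam) ∧ (∀ x, N < x → x ∉ abacus t lam) := by
  obtain ⟨N, hN⟩ := lam.eventually_zero
  refine ⟨N + |t| + lam.parts 0 + 1, ?_, ?_⟩
  · intro x hx
    have h1 := neg_abs_le t
    have h2 := le_abs_self t
    refine ⟨(t - 1 - x).toNat, ?_⟩
    have h3 : N ≤ (t - 1 - x).toNat := by omega
    rw [hN _ h3]
    omega
  · rintro x hx ⟨j, hj⟩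
    have h1 := neg_abs_le t
    have h2 := le_abs_self t
    have := lam.antitone' (Nat.zero_le j)
    omega

lemma beta_inj_s10 (lam : Ptn) {j k : ℕ} (h : j < k) :
    (lam.parts k : ℤ) - k < (lam.parts j : ℤ) - j := by
  have := lam.antitone' h.le
  omega

/-- condition for position `x` to give an addable node -/
lemma addb_pos (t : ℤ) (lam : Ptn) (x : ℤ) :
    (x - 1 ∈ abacus t lam ∧ x ∉ abacus t lam) ↔
    ∃ a : ℕ, x = (lam.parts a : ℤ) - a + t ∧ ∀ a', a' < a → lam.parts a < lam.parts a' := by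
  constructor
  · rintro ⟨⟨a, ha⟩, h⟩
    refine ⟨a, by omega, fun a' ha' => ?_⟩
    have h1 := lam.antitone' (show a' ≤ a - 1 by omega)
    have h2 := lam.antitone' (show a - 1 ≤ a by omega)
    by_contra hlt
    exact h ⟨a - 1, by omega⟩
  · rintro ⟨a, ha, h⟩
    refine ⟨⟨a, by omega⟩, ?_⟩
    rintro ⟨j, hj⟩
    rcases lt_or_ge j a with hja | hja
    · have := h j hja
      omega
    · have := lam.antitone' hja
      omega

lemma rem_pos (t : ℤ) (lam : Ptn) (x : ℤ) :
    (x ∈ abacus t lam ∧ x - 1 ∉ abacus t lam) ↔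
    ∃ a b : ℕ, x = (b : ℤ) - a + t ∧ b + 1 = lam.parts a ∧
      ∀ a', a < a' → lam.parts a' < lam.parts a := by
  constructor
  · rintro ⟨⟨a, ha⟩, h⟩
    have key : lam.parts (a + 1) < lam.parts a := by
      have h2 := lam.antitone' (show a ≤ a + 1 by omega)
      by_contra hlt
      exact h ⟨a + 1, by push_cast; omega⟩
    refine ⟨a, lam.parts a - 1, by omega, by omega, fun a' ha' => ?_⟩
    have h1 := lam.antitone' (show a + 1 ≤ a' by omega)
    omega
  · rintro ⟨a, b, ha, hb, h⟩
    refine ⟨⟨a, by omega⟩, ?_⟩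
    rintro ⟨j, hj⟩
    rcases lt_or_ge a j with hja | hja
    · have := h j hja
      omega
    · have := lam.antitone' hja
      omega

open Classical in
/-- indicator -/
noncomputable def chi (P : Prop) : ℤ := if P then 1 else 0

lemma ncard_finsum {α : Type*} (S : Set α) : (S.ncard : ℤ) = ∑ᶠ p, chi (p ∈ S) := by
  classical
  by_cases hS : S.Finite
  · rw [finsum_eq_sum_of_support_subset (s := hS.toFinset)]
    · rw [Set.ncard_eq_toFinset_card S hS, Finset.card_eq_sum_ones]
      push_cast
      refine Finset.sum_congr rfl fun x hx => ?_
      simp only [Set.Finite.mem_toFinset] at hx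
      simp [chi, hx]
    · intro x hx
      by_contra h
      simp at h
      simp [chi, h] at hx
  · rw [Set.Infinite.ncard hS, finsum_of_infinite_support]
    · simp
    · convert hS
      ext x
      simp [chi]

lemma chi_finite {α : Type*} {S : Set α} (h : S.Finite) :
    Function.HasFiniteSupport (fun p => chi (p ∈ S)) := by
  refine h.subset fun x hx => ?_
  by_contra hn
  simp [chi, hn] at hx

lemma ncard_diff {α : Type*} (P Q : α → Prop) (h1 : {x | P x ∧ ¬ Q x}.Finite)
    (h2 : {x | Q x ∧ ¬ P x}.Finite) :
    (({x | P x ∧ ¬ Q x}.ncard : ℤ) - ({x | Q x ∧ ¬ P x}.ncard : ℤ)) =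
      ∑ᶠ x, (chi (P x) - chi (Q x)) := by
  rw [ncard_finsum, ncard_finsum, ← finsum_sub_distrib (chi_finite h1) (chi_finite h2)]
  refine finsum_congr fun x => ?_
  by_cases hp : P x <;> by_cases hq : Q x <;> simp [chi, hp, hq]

lemma window_finite (e : ℕ) (he : 0 < e) {l : ℕ} (r : ℤ) (N : ℤ) :
    {p : Fin l × ℤ | -N ≤ p.2 * e + r ∧ p.2 * e + r ≤ N}.Finite := by
  refine (Set.finite_univ.prod (Set.finite_Icc (-(|N| + |r|)) (|N| + |r|))).subset ?_
  rintro ⟨c, q⟩ ⟨h1, h2⟩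
  refine ⟨trivial, ?_⟩
  simp only [Set.mem_Icc] at *
  have he' : (1 : ℤ) ≤ e := by exact_mod_cast he
  have a1 := neg_abs_le r
  have a2 := le_abs_self r
  have a3 := le_abs_self N
  have a4 := abs_nonneg N
  have a5 := abs_nonneg r
  constructor <;> nlinarith

lemma uniform_bounds {l : ℕ} (s : Fin l → ℤ) (lam : Fin l → Ptn) :
    ∃ N : ℤ, ∀ c, (∀ x, x < -N → x ∈ abacus (s c) (lam c)) ∧
      (∀ x, N < x → x ∉ abacus (s c) (lam c)) := by
  choose f hf using fun c => abacus_bounds (s c) (lam c)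
  refine ⟨∑ c, |f c|, fun c => ?_⟩
  have h1 : |f c| ≤ ∑ c, |f c| :=
    Finset.single_le_sum (f := fun c => |f c|) (fun i _ => abs_nonneg _) (Finset.mem_univ c)
  have h2 := le_abs_self (f c)
  exact ⟨fun x hx => (hf c).1 x (by omega), fun x hx => (hf c).2 x (by omega)⟩

lemma sets_finite (e : ℕ) (he : 0 < e) {l : ℕ} (s : Fin l → ℤ) (lam : Fin l → Ptn) (r : ℤ) :
    {p : Fin l × ℤ | p.2 * e + r - 1 ∈ abacus (s p.1) (lam p.1) ∧
      ¬ p.2 * e + r ∈ abacus (s p.1) (lam p.1)}.Finite ∧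
    {p : Fin l × ℤ | p.2 * e + r ∈ abacus (s p.1) (lam p.1) ∧
      ¬ p.2 * e + r - 1 ∈ abacus (s p.1) (lam p.1)}.Finite := by
  obtain ⟨N, hN⟩ := uniform_bounds s lam
  constructor
  · refine (window_finite e he r (|N| + 1)).subset ?_
    rintro ⟨c, q⟩ ⟨h1, h2⟩
    have a3 := le_abs_self N
    have e1 : -N ≤ q * e + r := by
      by_contra h
      exact h2 ((hN c).1 _ (not_le.1 h))
    have e2 : q * e + r - 1 ≤ N := by
      by_contra h
      exact (hN c).2 _ (not_le.1 h) h1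
    simp only [Set.mem_ofPred_eq]
    constructor <;> linarith
  · refine (window_finite e he r (|N| + 1)).subset ?_
    rintro ⟨c, q⟩ ⟨h1, h2⟩
    have a3 := le_abs_self N
    have e1 : -N ≤ q * e + r - 1 := by
      by_contra h
      exact h2 ((hN c).1 _ (not_le.1 h))
    have e2 : q * e + r ≤ N := by
      by_contra h
      exact (hN c).2 _ (not_le.1 h) h1
    simp only [Set.mem_ofPred_eq]
    constructor <;> linarith

lemma res_eq_iff (e : ℕ) (x r : ℤ) :
    ((x : ℤ) : ZMod e) = ((r : ℤ) : ZMod e) ↔ ∃ q : ℤ, x = q * e + r := by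
  rw [eq_comm, ZMod.intCast_eq_intCast_iff_dvd_sub]
  constructor
  · rintro ⟨q, hq⟩
    exact ⟨q, by linarith⟩
  · rintro ⟨q, hq⟩
    exact ⟨q, by linarith⟩

lemma mnum_eq (e : ℕ) (he : 0 < e) {l : ℕ} (s : Fin l → ℤ) (lam : Fin l → Ptn) (r : ℤ) :
    Mnum e s lam ((r : ℤ) : ZMod e) = ∑ᶠ p : Fin l × ℤ,
      (chi (p.2 * e + r - 1 ∈ abacus (s p.1) (lam p.1)) -
        chi (p.2 * e + r ∈ abacus (s p.1) (lam p.1))) := by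
  have he' : (e : ℤ) ≠ 0 := by exact_mod_cast he.ne'
  obtain ⟨f1, f2⟩ := sets_finite e he s lam r
  rw [← ncard_diff _ _ f1 f2, Mnum]
  congr 2
  · refine Set.ncard_congr
      (fun γ _ => (γ.2.2, ((γ.2.1 : ℤ) - γ.1 + s γ.2.2 - r) / e)) ?_ ?_ ?_
    · rintro ⟨a, b, c⟩ ⟨h, hr⟩
      rw [res, res_eq_iff] at hr
      obtain ⟨q, hq⟩ := hr
      rw [addable_iff] at h
      simp only at hq
      simp only [Set.mem_ofPred_eq]
      rw [hq, show q * e + r - r = q * e by ring, Int.mul_ediv_cancel _ he', addb_pos]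
      exact ⟨a, by rw [← hq, h.1], h.2⟩
    · rintro ⟨a, b, c⟩ ⟨a', b', c'⟩ ⟨h, hr⟩ ⟨h', hr'⟩ heq
      rw [res, res_eq_iff] at hr hr'
      obtain ⟨q, hq⟩ := hr
      obtain ⟨q', hq'⟩ := hr'
      rw [addable_iff] at h h'
      simp only [Prod.mk.injEq] at heq hq hq' ⊢
      obtain ⟨rfl, heq⟩ := heq
      rw [hq, hq', show q * e + r - r = q * e by ring, show q' * e + r - r = q' * e by ring,
        Int.mul_ediv_cancel _ he', Int.mul_ediv_cancel _ he'] at heq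
      subst heq
      rcases lt_trichotomy a a' with hlt | rfl | hlt
      · have := beta_inj_s10 (lam c) hlt; omega
      · exact ⟨rfl, by omega, rfl⟩
      · have := beta_inj_s10 (lam c) hlt; omega
    · rintro ⟨c, q⟩ h
      simp only [Set.mem_ofPred_eq] at h
      rw [addb_pos] at h
      obtain ⟨a, ha, h⟩ := h
      refine ⟨(a, (lam c).parts a, c), ⟨(addable_iff _ _ _ _).2 ⟨rfl, h⟩, ?_⟩, ?_⟩
      · rw [res, res_eq_iff]
        exact ⟨q, ha.symm⟩
      · simp only
        rw [← ha, show q * e + r - r = q * e by ring, Int.mul_ediv_cancel _ he']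
  · refine Set.ncard_congr
      (fun γ _ => (γ.2.2, ((γ.2.1 : ℤ) - γ.1 + s γ.2.2 - r) / e)) ?_ ?_ ?_
    · rintro ⟨a, b, c⟩ ⟨h, hr⟩
      rw [res, res_eq_iff] at hr
      obtain ⟨q, hq⟩ := hr
      rw [removable_iff] at h
      simp only at hq
      simp only [Set.mem_ofPred_eq]
      rw [hq, show q * e + r - r = q * e by ring, Int.mul_ediv_cancel _ he', rem_pos]
      exact ⟨a, b, by rw [← hq], h.1, h.2⟩
    · rintro ⟨a, b, c⟩ ⟨a', b', c'⟩ ⟨h, hr⟩ ⟨h', hr'⟩ heq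
      rw [res, res_eq_iff] at hr hr'
      obtain ⟨q, hq⟩ := hr
      obtain ⟨q', hq'⟩ := hr'
      rw [removable_iff] at h h'
      simp only [Prod.mk.injEq] at heq hq hq' ⊢
      obtain ⟨rfl, heq⟩ := heq
      rw [hq, hq', show q * e + r - r = q * e by ring, show q' * e + r - r = q' * e by ring,
        Int.mul_ediv_cancel _ he', Int.mul_ediv_cancel _ he'] at heq
      subst heq
      rcases lt_trichotomy a a' with hlt | rfl | hlt
      · have := beta_inj_s10 (lam c) hlt; omega
      · exact ⟨rfl, by omega, rfl⟩
      · have := beta_inj_s10 (lam c) hlt; omega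
    · rintro ⟨c, q⟩ h
      simp only [Set.mem_ofPred_eq] at h
      rw [rem_pos] at h
      obtain ⟨a, b, ha, hb, h⟩ := h
      refine ⟨(a, b, c), ⟨(removable_iff _ _ _ _).2 ⟨hb, h⟩, ?_⟩, ?_⟩
      · rw [res, res_eq_iff]
        exact ⟨q, ha.symm⟩
      · simp only
        rw [← ha, show q * e + r - r = q * e by ring, Int.mul_ediv_cancel _ he']

lemma mnum_one_eq (e : ℕ) (he : 0 < e) (t : ℤ) (mu : Ptn) (r : ℤ) :
    Mnum₁ e t mu ((r : ℤ) : ZMod e) = ∑ᶠ k : ℤ,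
      (chi (k * e + r - 1 ∈ abacus t mu) - chi (k * e + r ∈ abacus t mu)) := by
  rw [Mnum₁, mnum_eq e he]
  exact finsum_comp_equiv (Equiv.uniqueProd ℤ (Fin 1))
    (f := fun k : ℤ => chi (k * e + r - 1 ∈ abacus t mu) - chi (k * e + r ∈ abacus t mu))

lemma phi_bij (l : ℕ) (hl : 1 ≤ l) :
    Function.Bijective (fun p : Fin l × ℤ => p.2 * l + ((l : ℤ) - 1 - (p.1 : ℕ))) := by
  have hl' : (0 : ℤ) < l := by exact_mod_cast hl
  constructor
  · rintro ⟨c, q⟩ ⟨c', q'⟩ h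
    simp only at h
    have h1 := c.2
    have h2 := c'.2
    have hq : q = q' := by
      rcases lt_trichotomy q q' with hlt | hh | hlt
      · nlinarith
      · exact hh
      · nlinarith
    subst hq
    simp only [Prod.mk.injEq, and_true]
    apply Fin.ext
    omega
  · intro k
    have h1 := Int.emod_nonneg k hl'.ne'
    have h2 := Int.emod_lt_of_pos k hl'
    have h3 := Int.emod_add_mul_ediv k l
    refine ⟨(⟨((l : ℤ) - 1 - k % l).toNat, by omega⟩, k / l), ?_⟩
    simp only
    rw [Int.toNat_of_nonneg (by omega)]
    linarith

lemma mem_uglov_iff (e : ℕ) {l : ℕ} (hl : 1 ≤ l) (s : Fin l → ℤ) (lam : Fin l → Ptn)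
    (c : Fin l) (q r : ℤ) (h0 : 0 ≤ r) (hr : r < e) :
    (q * l + ((l : ℤ) - 1 - (c : ℕ))) * e + r ∈ uglovSet e s lam ↔
      q * e + r ∈ abacus (s c) (lam c) := by
  lift r to ℕ using h0
  have hr' : r < e := by exact_mod_cast hr
  constructor
  · rintro ⟨c', q', r', hr'', hm, heq⟩
    have h1 : (q * l + ((l : ℤ) - 1 - (c : ℕ))) * e + r =
        (q' * l + ((l : ℤ) - 1 - (c' : ℕ))) * e + r' := by rw [heq]; ring
    have h2 : (q * l + ((l : ℤ) - 1 - (c : ℕ))) = (q' * l + ((l : ℤ) - 1 - (c' : ℕ))) := by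
      generalize (q * l + ((l : ℤ) - 1 - (c : ℕ))) = A at *
      generalize (q' * l + ((l : ℤ) - 1 - (c' : ℕ))) = B at *
      rcases lt_trichotomy A B with hlt | hh | hlt
      · nlinarith
      · exact hh
      · nlinarith
    have h3 : (r : ℤ) = r' := by rw [h2] at h1; linarith
    have h4 := (phi_bij l hl).1 (a₁ := (c, q)) (a₂ := (c', q')) h2
    simp only [Prod.mk.injEq] at h4
    obtain ⟨rfl, rfl⟩ := h4
    rwa [h3]
  · intro h
    exact ⟨c, q, r, hr', h, by ring⟩

lemma tele_one (h : ℤ → ℤ) (N : ℤ) (h1 : ∀ k, k < -N → h k = 1) (h2 : ∀ k, N < k → h k = 0) :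
    Function.HasFiniteSupport (fun k => h (k - 1) - h k) ∧ ∑ᶠ k, (h (k - 1) - h k) = 1 := by
  have hsub : Function.support (fun k => h (k - 1) - h k) ⊆
      ((Finset.range (2 * N.natAbs + 4)).image
        (fun n : ℕ => (n : ℤ) - (N.natAbs + 1)) : Finset ℤ) := by
    intro k hk
    simp only [Finset.coe_image, Set.mem_image, Finset.coe_range, Set.mem_Iio]
    refine ⟨(k + (N.natAbs + 1)).toNat, ?_⟩
    by_contra hcon
    apply hk
    simp only
    rcases lt_or_ge k (-(N.natAbs : ℤ) - 1) with hh | hh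
    · rw [h1 _ (by omega), h1 _ (by omega)]; rfl
    · rcases lt_or_ge (N.natAbs + 2 : ℤ) k with hh' | hh'
      · rw [h2 _ (by omega), h2 _ (by omega)]; rfl
      · exact absurd ⟨by omega, by omega⟩ hcon
  refine ⟨(Finset.finite_toSet _).subset hsub, ?_⟩
  rw [finsum_eq_sum_of_support_subset _ hsub, Finset.sum_image (by intro a _ b _ hab; simpa using hab)]
  have := Finset.sum_range_sub' (fun n : ℕ => h ((n : ℤ) - (N.natAbs + 1) - 1))
    (2 * N.natAbs + 4)
  rw [h1 _ (by omega), h2 _ (by omega)] at this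
  rw [sub_zero] at this
  refine Eq.trans ?_ this
  refine Finset.sum_congr rfl fun n _ => ?_
  congr 2
  push_cast
  ring

lemma tele (h : ℤ → ℤ) (N : ℤ) (h1 : ∀ k, k < -N → h k = 1) (h2 : ∀ k, N < k → h k = 0) (n : ℕ) :
    Function.HasFiniteSupport (fun k => h (k - n) - h k) ∧ ∑ᶠ k, (h (k - n) - h k) = n := by
  induction n with
  | zero => simp [Function.HasFiniteSupport]
  | succ n ih =>
    have := tele_one (fun k => h (k - n)) (|N| + n)
      (fun k hk => h1 _ (by have := le_abs_self N; omega))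
      (fun k hk => h2 _ (by have := le_abs_self N; omega))
    have heq : ∀ k, h (k - (n + 1 : ℕ)) - h k =
        (h (k - 1 - n) - h (k - n)) + (h (k - n) - h k) := by
      intro k
      rw [show k - (n + 1 : ℕ) = k - 1 - n by push_cast; ring]
      ring
    simp only [heq]
    refine ⟨(this.1.union ih.1).subset (Function.support_add _ _), ?_⟩
    rw [finsum_add_distrib this.1 ih.1, this.2, ih.2]
    push_cast
    ring

/-- comparison of `M_i` under the Uglov map. -/
theorem stmt10 (e l : ℕ) (he : 2 ≤ e) (hl : 1 ≤ l) (s : Fin l → ℤ) (hs : Abar e s)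
    (lam : Fin l → Ptn) (mu : Ptn) (hmu : IsUglov e s lam mu) (i : ZMod e) :
    (i ≠ 0 → Mnum e s lam i = Mnum₁ e (∑ k, s k) mu i) ∧
      Mnum e s lam 0 = Mnum₁ e (∑ k, s k) mu 0 + (l : ℤ) - 1 := by
  have he0 : 0 < e := by omega
  have hel : (0 : ℤ) < e := by exact_mod_cast he0
  rw [IsUglov] at hmu
  have key : ∀ (c : Fin l) (q r : ℤ), 0 ≤ r → r < e →
      ((q * e + r ∈ abacus (s c) (lam c)) ↔
        (q * l + ((l : ℤ) - 1 - (c : ℕ))) * e + r ∈ abacus (∑ k, s k) mu) := by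
    intro c q r h0 hr
    rw [hmu, mem_uglov_iff e hl s lam c q r h0 hr]
  constructor
  · intro hi
    obtain ⟨r, rfl⟩ : ∃ r : ℤ, ((r : ℤ) : ZMod e) = i := ZMod.intCast_surjective i
    have hrr : ((r : ℤ) : ZMod e) = ((r % e : ℤ) : ZMod e) := by simp
    have h0 := Int.emod_nonneg r hel.ne'
    have h1 := Int.emod_lt_of_pos r hel
    rw [hrr] at hi ⊢
    generalize r % e = r' at *
    have hr0 : r' ≠ 0 := by
      rintro rfl
      simp at hi
    rw [mnum_eq e he0, mnum_one_eq e he0]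
    refine finsum_eq_of_bijective _ (phi_bij l hl) ?_
    rintro ⟨c, q⟩
    simp only
    rw [add_sub_assoc, add_sub_assoc, key c q r' h0 h1, key c q (r' - 1) (by omega) (by omega)]
  · have hz : (0 : ZMod e) = ((0 : ℤ) : ZMod e) := by simp
    rw [hz, mnum_eq e he0, mnum_one_eq e he0]
    set L := abacus (∑ k, s k) mu with hL
    obtain ⟨N, hN1, hN2⟩ := abacus_bounds (∑ k, s k) mu
    have hstep : ∑ᶠ p : Fin l × ℤ,
      (chi (p.2 * e + 0 - 1 ∈ abacus (s p.1) (lam p.1)) -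
        chi (p.2 * e + 0 ∈ abacus (s p.1) (lam p.1))) =
        ∑ᶠ k : ℤ, (chi ((k - (l - 1 : ℕ)) * e - 1 ∈ L) - chi (k * e + 0 ∈ L)) := by
      refine finsum_eq_of_bijective _ (phi_bij l hl) ?_
      rintro ⟨c, q⟩
      simp only
      rw [key c q 0 le_rfl hel,
        show q * (e : ℤ) + 0 - 1 = (q - 1) * e + (e - 1) by ring,
        key c (q - 1) (e - 1) (by omega) (by omega)]
      congr 3
      push_cast [hl]
      ring_nf
    rw [hstep]
    have ht := tele (fun k => chi (k * e - 1 ∈ L)) (|N| + 1) ?_ ?_ (l - 1)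
    · have hf : Function.HasFiniteSupport
          (fun k : ℤ => chi (k * e + 0 - 1 ∈ L) - chi (k * e + 0 ∈ L)) := by
        obtain ⟨f1, f2⟩ := sets_finite e he0 (fun _ : Fin 1 => ∑ k, s k) (fun _ => mu) 0
        refine ((f1.union f2).image Prod.snd).subset ?_
        intro k hk
        refine ⟨(0, k), ?_, rfl⟩
        by_contra hcon
        apply hk
        simp only [Set.mem_union, Set.mem_ofPred_eq, ← hL] at hcon
        by_cases hp : k * e + 0 - 1 ∈ L <;> by_cases hq : k * e + 0 ∈ L <;>
          simp_all [chi]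
      have hs2 : ∑ᶠ k : ℤ, (chi ((k - (l - 1 : ℕ)) * e - 1 ∈ L) - chi (k * e + 0 ∈ L)) =
          ∑ᶠ k : ℤ, ((chi ((k - (l - 1 : ℕ)) * e - 1 ∈ L) - chi (k * e - 1 ∈ L)) +
            (chi (k * e + 0 - 1 ∈ L) - chi (k * e + 0 ∈ L))) := by
        refine finsum_congr fun k => ?_
        rw [show k * (e : ℤ) + 0 - 1 = k * e - 1 by ring]
        ring
      rw [hs2, finsum_add_distrib ht.1 hf, ht.2]
      push_cast [hl]
      ring
    · intro k hk
      have := hN1 (k * e - 1) (by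
        have a3 := neg_abs_le N
        have a4 := abs_nonneg N
        have a5 := le_abs_self N
        nlinarith)
      simp only [hL]
      simp [chi, this]
    · intro k hk
      have := hN2 (k * e - 1) (by
        have a4 := abs_nonneg N
        have a5 := le_abs_self N
        nlinarith)
      simp only [hL]
      simp [chi, this]
end
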